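/- arXiv:1601.05445 — 2 statements merged into one kernel-verified Lean document; each statement's English description precedes it below -/
import Mathlib

section
/- For every ε > 0 there exists δ > 0 such that for every unital AF algebra A, every complex Hilbert space H, every von Neumann algebra M on H, and every δ-*-homomorphism φ : A → M, there is a *-homomorphism ψ : A → M such that ‖φ(x) − ψ(x)‖ < ε for every x in the closed unit ball of A. -/
/-- `φ : A → B` (not assumed linear or continuous) is an `ε`-*-homomorphism. -/
def IsApproxStarHom {A B : Type*}
    [NonUnitalNormedRing A] [StarRing A] [Module ℂ A]
    [NonUnitalNormedRing B] [StarRing B] [Module ℂ B]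
    (ε : ℝ) (φ : A → B) : Prop :=
  (∀ x y : A, ‖x‖ ≤ 1 → ‖y‖ ≤ 1 → ‖φ (x + y) - φ x - φ y‖ ≤ ε) ∧
  (∀ (x : A) (l : ℂ), ‖x‖ ≤ 1 → ‖l‖ ≤ 1 → ‖φ (l • x) - l • φ x‖ ≤ ε) ∧
  (∀ x y : A, ‖x‖ ≤ 1 → ‖y‖ ≤ 1 → ‖φ (x * y) - φ x * φ y‖ ≤ ε) ∧
  (∀ x : A, ‖x‖ ≤ 1 → ‖φ (star x) - star (φ x)‖ ≤ ε) ∧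
  (∀ x : A, ‖x‖ ≤ 1 → ‖φ x‖ ≤ 1 + ε)

/-- A unital C*-algebra is AF if it admits a directed family of finite-dimensional
unital *-subalgebras whose union is dense. -/
def IsAFAlgebra (A : Type*) [NormedRing A] [StarRing A] [CStarRing A]
    [NormedAlgebra ℂ A] [StarModule ℂ A] [CompleteSpace A] : Prop :=
  ∃ 𝒮 : Set (StarSubalgebra ℂ A), 𝒮.Nonempty ∧ DirectedOn (· ≤ ·) 𝒮 ∧
    (∀ S ∈ 𝒮, FiniteDimensional ℂ S) ∧ Dense (⋃ S ∈ 𝒮, (S : Set A))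

universe u v


open scoped BoundedContinuousFunction InnerProductSpace ComplexStarModule
open Filter Topology

set_option linter.unusedSectionVars false
namespace UlamAF

section forms
variable {H : Type*} [NormedAddCommGroup H] [InnerProductSpace ℂ H] [CompleteSpace H]

theorem exists_op_of_form (B : H → H → ℂ) (K : ℝ)
    (add_left : ∀ x y z, B (x + y) z = B x z + B y z)
    (add_right : ∀ x y z, B x (y + z) = B x y + B x z)
    (smul_left : ∀ (c : ℂ) x y, B (c • x) y = starRingEnd ℂ c * B x y)
    (smul_right : ∀ (c : ℂ) x y, B x (c • y) = c * B x y)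
    (bound : ∀ x y, ‖B x y‖ ≤ K * ‖x‖ * ‖y‖) :
    ∃ b : H →L[ℂ] H, ∀ x y, ⟪x, b y⟫_ℂ = B x y := by
  let L : H →ₗ⋆[ℂ] H →ₗ[ℂ] ℂ :=
    LinearMap.mk₂'ₛₗ (starRingEnd ℂ) (RingHom.id ℂ) B add_left
      (by intro c x y; simpa using smul_left c x y) add_right
      (by intro c x y; simpa using smul_right c x y)
  let C : H →L⋆[ℂ] H →L[ℂ] ℂ := L.mkContinuous₂ K bound
  refine ⟨ContinuousLinearMap.adjoint (InnerProductSpace.continuousLinearMapOfBilin C), ?_⟩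
  intro x y
  rw [ContinuousLinearMap.adjoint_inner_right, InnerProductSpace.continuousLinearMapOfBilin_apply]
  rfl

theorem op_ext {a b : H →L[ℂ] H} (h : ∀ x y, ⟪x, a y⟫_ℂ = ⟪x, b y⟫_ℂ) : a = b := by
  ext y
  exact ext_inner_left ℂ (fun x => h x y)

theorem op_norm_le {a : H →L[ℂ] H} {K : ℝ} (hK : 0 ≤ K)
    (h : ∀ x y, ‖⟪x, a y⟫_ℂ‖ ≤ K * ‖x‖ * ‖y‖) : ‖a‖ ≤ K := by
  refine ContinuousLinearMap.opNorm_le_bound _ hK (fun y => ?_)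
  have := h (a y) y
  rw [norm_inner_symm, inner_self_eq_norm_sq_to_K] at this
  by_cases h0 : ‖a y‖ = 0
  · rw [h0]; positivity
  · have hp : 0 < ‖a y‖ := lt_of_le_of_ne (norm_nonneg _) (Ne.symm h0)
    have h2 : ‖a y‖ * ‖a y‖ ≤ ‖a y‖ * (K * ‖y‖) := by
      have : ‖a y‖ ^ 2 ≤ K * ‖a y‖ * ‖y‖ := by simpa using this
      nlinarith
    exact le_of_mul_le_mul_left h2 hp

theorem mem_vN (M : VonNeumannAlgebra H) {b : H →L[ℂ] H}
    (h : ∀ z : H →L[ℂ] H, (∀ g ∈ M, g * z = z * g) → z * b = b * z) : b ∈ M := by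
  rw [← VonNeumannAlgebra.commutant_commutant M, VonNeumannAlgebra.mem_commutant_iff]
  intro z hz
  exact h z (VonNeumannAlgebra.mem_commutant_iff.1 hz)

theorem vN_isClosed (M : VonNeumannAlgebra H) : IsClosed (M : Set (H →L[ℂ] H)) := by
  rw [← VonNeumannAlgebra.centralizer_centralizer]
  exact Set.isClosed_centralizer _

theorem vN_smul_mem (M : VonNeumannAlgebra H) (c : ℂ) {b : H →L[ℂ] H} (h : b ∈ M) : c • b ∈ M :=
  SMulMemClass.smul_mem (s := M.toStarSubalgebra) c h

/-- weak limits along an ultrafilter -/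
theorem exists_wlim {ι : Type*} (U : Ultrafilter ι) (a : ι → (H →L[ℂ] H)) (K : ℝ)
    (ha : ∀ i, ‖a i‖ ≤ K) :
    ∃ b : H →L[ℂ] H, ∀ x y, Tendsto (fun i => ⟪x, a i y⟫_ℂ) U (𝓝 ⟪x, b y⟫_ℂ) := by
  have hb : ∀ x y i, ‖⟪x, a i y⟫_ℂ‖ ≤ K * ‖x‖ * ‖y‖ := fun x y i => by
    calc ‖⟪x, a i y⟫_ℂ‖ ≤ ‖x‖ * ‖a i y‖ := norm_inner_le_norm _ _
      _ ≤ ‖x‖ * (K * ‖y‖) := by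
        gcongr
        exact (a i).le_of_opNorm_le (ha i) y
      _ = _ := by ring
  have hex : ∀ x y, ∃ c : ℂ, Tendsto (fun i => ⟪x, a i y⟫_ℂ) U (𝓝 c) := fun x y => by
    obtain ⟨c, -, hc⟩ := (isCompact_closedBall (0 : ℂ) (K * ‖x‖ * ‖y‖)).ultrafilter_le_nhds
      (U.map (fun i => ⟪x, a i y⟫_ℂ)) (by
        rw [Filter.le_principal_iff]
        refine Filter.mem_map.2 (Filter.univ_mem' fun i => ?_)
        simpa using hb x y i)
    exact ⟨c, hc⟩
  choose B hB using hex
  obtain ⟨b, hb'⟩ := exists_op_of_form B K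
    (fun x y z => tendsto_nhds_unique (hB _ _) (by
      simpa only [inner_add_left] using (hB x z).add (hB y z)))
    (fun x y z => tendsto_nhds_unique (hB _ _) (by
      simpa only [inner_add_right, map_add] using (hB x y).add (hB x z)))
    (fun c x y => tendsto_nhds_unique (hB _ _) (by
      simpa only [inner_smul_left] using (hB x y).const_mul (starRingEnd ℂ c)))
    (fun c x y => tendsto_nhds_unique (hB _ _) (by
      simpa only [inner_smul_right, map_smul] using (hB x y).const_mul c))
    (fun x y => le_of_tendsto (hB x y).norm (Eventually.of_forall (hb x y)))
  exact ⟨b, fun x y => by rw [hb']; exact hB x y⟩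

theorem wlim_norm_le {ι : Type*} (U : Ultrafilter ι) {a : ι → (H →L[ℂ] H)} {b : H →L[ℂ] H}
    (h : ∀ x y, Tendsto (fun i => ⟪x, a i y⟫_ℂ) U (𝓝 ⟪x, b y⟫_ℂ)) {K : ℝ} (hK : 0 ≤ K)
    (ha : ∀ᶠ i in U, ‖a i‖ ≤ K) : ‖b‖ ≤ K := by
  refine op_norm_le hK fun x y => le_of_tendsto (h x y).norm (ha.mono fun i hi => ?_)
  calc ‖⟪x, a i y⟫_ℂ‖ ≤ ‖x‖ * ‖a i y‖ := norm_inner_le_norm _ _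
      _ ≤ ‖x‖ * (K * ‖y‖) := by
        gcongr
        exact (a i).le_of_opNorm_le hi y
      _ = _ := by ring

theorem wlim_sub {ι : Type*} (U : Ultrafilter ι) {a a' : ι → (H →L[ℂ] H)} {b b' : H →L[ℂ] H}
    (h : ∀ x y, Tendsto (fun i => ⟪x, a i y⟫_ℂ) U (𝓝 ⟪x, b y⟫_ℂ))
    (h' : ∀ x y, Tendsto (fun i => ⟪x, a' i y⟫_ℂ) U (𝓝 ⟪x, b' y⟫_ℂ)) :
    ∀ x y, Tendsto (fun i => ⟪x, (a i - a' i) y⟫_ℂ) U (𝓝 ⟪x, (b - b') y⟫_ℂ) := fun x y => by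
  simpa only [sub_apply, inner_sub_right] using (h x y).sub (h' x y)

theorem wlim_mem {ι : Type*} (U : Ultrafilter ι) {a : ι → (H →L[ℂ] H)} {b : H →L[ℂ] H}
    (h : ∀ x y, Tendsto (fun i => ⟪x, a i y⟫_ℂ) U (𝓝 ⟪x, b y⟫_ℂ)) (M : VonNeumannAlgebra H)
    (ha : ∀ i, a i ∈ M) : b ∈ M := by
  refine mem_vN M fun z hz => op_ext fun x y => ?_
  have h1 := h (ContinuousLinearMap.adjoint z x) y
  have h2 := h x (z y)
  simp only [ContinuousLinearMap.adjoint_inner_left] at h1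
  have e : ∀ i, z (a i y) = a i (z y) := fun i =>
    (congrArg (fun T : H →L[ℂ] H => T y) (hz _ (ha i))).symm
  simp only [e] at h1
  exact tendsto_nhds_unique h1 h2

end forms

/-- A right invariant mean on bounded continuous functions. -/
structure InvMean (G : Type*) [Group G] [TopologicalSpace G] where
  m : (G →ᵇ ℂ) →ₗ[ℂ] ℂ
  bound : ∀ g, ‖m g‖ ≤ ‖g‖
  one : m 1 = 1
  inv : ∀ (g g' : G →ᵇ ℂ) (x : G), (∀ u, g' u = g (u * x)) → m g' = m g
  star : ∀ g, m (star g) = star (m g)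

section opM
variable {H : Type*} [NormedAddCommGroup H] [InnerProductSpace ℂ H] [CompleteSpace H]
variable {G : Type*} [Group G] [TopologicalSpace G]

noncomputable def coef (f : G →ᵇ (H →L[ℂ] H)) (x y : H) : G →ᵇ ℂ :=
  ((innerSL ℂ x) ∘L (ContinuousLinearMap.apply ℂ H y)).compLeftContinuousBounded G f

@[simp] theorem coef_apply (f : G →ᵇ (H →L[ℂ] H)) (x y : H) (u : G) :
    coef f x y u = ⟪x, f u y⟫_ℂ := rfl

theorem coef_norm_le (f : G →ᵇ (H →L[ℂ] H)) (x y : H) {K : ℝ} (hK : 0 ≤ K)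
    (hf : ∀ u, ‖f u‖ ≤ K) : ‖coef f x y‖ ≤ K * ‖x‖ * ‖y‖ := by
  refine (BoundedContinuousFunction.norm_le (by positivity)).2 fun u => ?_
  calc ‖⟪x, f u y⟫_ℂ‖ ≤ ‖x‖ * ‖f u y‖ := norm_inner_le_norm _ _
      _ ≤ ‖x‖ * (K * ‖y‖) := by
        gcongr
        exact (f u).le_of_opNorm_le (hf u) y
      _ = _ := by ring

theorem exists_opM (m : InvMean G) (f : G →ᵇ (H →L[ℂ] H)) :
    ∃ b : H →L[ℂ] H, ∀ x y, ⟪x, b y⟫_ℂ = m.m (coef f x y) := by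
  refine exists_op_of_form _ ‖f‖ ?_ ?_ ?_ ?_ ?_
  · intro x y z
    rw [← map_add]; congr 1; ext u; simp
  · intro x y z
    rw [← map_add]; congr 1; ext u; simp
  · intro c x y
    rw [← smul_eq_mul, ← map_smul]; congr 1; ext u; simp [mul_comm]
  · intro c x y
    rw [← smul_eq_mul, ← map_smul]; congr 1; ext u; simp
  · intro x y
    exact (m.bound _).trans (coef_norm_le f x y (norm_nonneg _) f.norm_coe_le_norm)

noncomputable def opM (m : InvMean G) (f : G →ᵇ (H →L[ℂ] H)) : H →L[ℂ] H :=
  (exists_opM m f).choose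

theorem opM_inner (m : InvMean G) (f : G →ᵇ (H →L[ℂ] H)) (x y : H) :
    ⟪x, opM m f y⟫_ℂ = m.m (coef f x y) := (exists_opM m f).choose_spec x y

theorem opM_norm_le (m : InvMean G) (f : G →ᵇ (H →L[ℂ] H)) {K : ℝ} (hK : 0 ≤ K)
    (hf : ∀ u, ‖f u‖ ≤ K) : ‖opM m f‖ ≤ K :=
  op_norm_le hK fun x y => by
    rw [opM_inner]; exact (m.bound _).trans (coef_norm_le f x y hK hf)

theorem opM_sub (m : InvMean G) (f g : G →ᵇ (H →L[ℂ] H)) :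
    opM m (f - g) = opM m f - opM m g := op_ext fun x y => by
  rw [sub_apply, inner_sub_right, opM_inner, opM_inner, opM_inner, ← map_sub]
  congr 1; ext u; simp

theorem opM_add (m : InvMean G) (f g : G →ᵇ (H →L[ℂ] H)) :
    opM m (f + g) = opM m f + opM m g := op_ext fun x y => by
  rw [add_apply, inner_add_right, opM_inner, opM_inner, opM_inner, ← map_add]
  congr 1; ext u; simp

theorem opM_const (m : InvMean G) (a : H →L[ℂ] H) :
    opM m (BoundedContinuousFunction.const G a) = a := op_ext fun x y => by
  rw [opM_inner]
  have : coef (BoundedContinuousFunction.const G a) x y = (⟪x, a y⟫_ℂ) • (1 : G →ᵇ ℂ) := by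
    ext u; simp
  rw [this, map_smul, m.one]; simp

theorem opM_mul_const (m : InvMean G) (f : G →ᵇ (H →L[ℂ] H)) (a : H →L[ℂ] H) :
    opM m (f * BoundedContinuousFunction.const G a) = opM m f * a := op_ext fun x y => by
  rw [opM_inner, mul_apply_eq_comp, opM_inner]
  congr 1

theorem opM_const_mul (m : InvMean G) (f : G →ᵇ (H →L[ℂ] H)) (a : H →L[ℂ] H) :
    opM m (BoundedContinuousFunction.const G a * f) = a * opM m f := op_ext fun x y => by
  rw [opM_inner, mul_apply_eq_comp, ← ContinuousLinearMap.adjoint_inner_left, opM_inner]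
  congr 1
  ext u
  simp [ContinuousLinearMap.adjoint_inner_left]

theorem opM_star (m : InvMean G) (f : G →ᵇ (H →L[ℂ] H)) :
    opM m (star f) = star (opM m f) := op_ext fun x y => by
  rw [opM_inner, ContinuousLinearMap.star_eq_adjoint, ContinuousLinearMap.adjoint_inner_right,
    ← inner_conj_symm, opM_inner]
  rw [starRingEnd_apply, ← m.star]
  congr 1
  ext u
  simp [ContinuousLinearMap.star_eq_adjoint, ContinuousLinearMap.adjoint_inner_right]

theorem opM_inv (m : InvMean G) (f g : G →ᵇ (H →L[ℂ] H)) (x : G) (h : ∀ u, g u = f (u * x)) :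
    opM m g = opM m f := op_ext fun y z => by
  rw [opM_inner, opM_inner]
  exact m.inv _ _ x fun u => by simp [h]

theorem opM_mem (m : InvMean G) (f : G →ᵇ (H →L[ℂ] H)) (M : VonNeumannAlgebra H)
    (h : ∀ u, f u ∈ M) : opM m f ∈ M := by
  refine mem_vN M fun z hz => ?_
  rw [← opM_const_mul, ← opM_mul_const]
  congr 1
  ext1 u
  exact (hz _ (h u)).symm

end opM
end UlamAF


open scoped BoundedContinuousFunction InnerProductSpace ComplexStarModule
open Filter Topology
set_option linter.unusedSectionVars false
namespace UlamAF

section newton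
variable {H : Type*} [NormedAddCommGroup H] [InnerProductSpace ℂ H] [CompleteSpace H]

theorem op_norm_one_le : ‖(1 : H →L[ℂ] H)‖ ≤ 1 := ContinuousLinearMap.norm_id_le

theorem exists_invsqrt (M : VonNeumannAlgebra H) {D : H →L[ℂ] H} (hD : IsSelfAdjoint D)
    (hM : D ∈ M) {ε : ℝ} (hε : ε ≤ 1 / 2) (h : ‖D - 1‖ ≤ ε) :
    ∃ S ∈ M, IsSelfAdjoint S ∧ S * D * S = 1 ∧ ‖S - 1‖ ≤ ε := by
  have hspec : ∀ t ∈ spectrum ℝ D, |t - 1| ≤ ε := fun t ht => by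
    have h1 : cfc (fun t : ℝ => t - 1) D = D - 1 := by
      rw [cfc_sub (fun t : ℝ => t) (fun _ => 1) D, cfc_id' ℝ D, cfc_const_one ℝ D]
    have h2 := norm_apply_le_norm_cfc (fun t : ℝ => t - 1) D ht
    rw [h1] at h2
    exact h2.trans h
  have hpos : ∀ t ∈ spectrum ℝ D, 0 < t := fun t ht => by
    have := abs_le.1 (hspec t ht); linarith
  have hcont : ContinuousOn (fun t : ℝ => (√t)⁻¹) (spectrum ℝ D) := by
    refine ContinuousOn.inv₀ (Real.continuous_sqrt.continuousOn) fun t ht => ?_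
    exact (Real.sqrt_pos.2 (hpos t ht)).ne'
  refine ⟨cfc (fun t : ℝ => (√t)⁻¹) D, ?_, cfc_predicate _ _, ?_, ?_⟩
  · refine mem_vN M fun z hz => ?_
    have : Commute D z := hz D hM
    exact (IsSelfAdjoint.commute_cfc hD this _).symm
  · have : cfc (fun t : ℝ => (√t)⁻¹ * t * (√t)⁻¹) D = 1 := by
      rw [← cfc_const_one ℝ D]
      refine cfc_congr fun t ht => ?_
      have hp := hpos t ht
      have h0 := (Real.sqrt_pos.2 hp).ne'
      show (√t)⁻¹ * t * (√t)⁻¹ = 1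
      field_simp
      exact (Real.sq_sqrt hp.le).symm
    rw [← this, cfc_mul (fun t : ℝ => (√t)⁻¹ * t) (fun t : ℝ => (√t)⁻¹) D
      (hcont.mul continuousOn_id) hcont, cfc_mul (fun t : ℝ => (√t)⁻¹) (fun t : ℝ => t) D hcont,
      cfc_id' ℝ D]
  · have h1 : cfc (fun t : ℝ => (√t)⁻¹ - 1) D = cfc (fun t : ℝ => (√t)⁻¹) D - 1 := by
      rw [cfc_sub (fun t : ℝ => (√t)⁻¹) (fun _ => 1) D hcont, cfc_const_one ℝ D]
    rw [← h1]
    refine norm_cfc_le ((norm_nonneg _).trans h) fun t ht => ?_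
    have hp := hpos t ht
    have hs := hspec t ht
    have h0 := Real.sqrt_pos.2 hp
    have h2 := Real.sq_sqrt hp.le
    set s := √t with hsdef
    rw [← h2] at hs
    have e : s⁻¹ - 1 = (1 - s) / s := by field_simp
    have habs : |s ^ 2 - 1| = |1 - s| * (1 + s) := by
      rw [show s ^ 2 - 1 = -((1 - s) * (1 + s)) by ring, abs_neg, abs_mul, abs_of_pos (by linarith : 0 < 1 + s)]
    rw [Real.norm_eq_abs, e, abs_div, abs_of_pos h0, div_le_iff₀ h0]
    rw [habs] at hs
    have hs2 := abs_le.1 (hspec t ht)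
    have hsl : 1 / 2 ≤ s := by nlinarith
    have hss : 1 ≤ s * (1 + s) := by nlinarith
    have hε0 : 0 ≤ ε := (norm_nonneg _).trans h
    have : |1 - s| * 1 ≤ (|1 - s| * (1 + s)) * s := by
      have := mul_le_mul_of_nonneg_left hss (abs_nonneg (1 - s))
      linarith
    have := mul_le_mul_of_nonneg_right hs h0.le
    linarith

variable {G : Type*} [Group G]

/-- approximately multiplicative, approximately unitary maps -/
structure AH (M : VonNeumannAlgebra H) (ε : ℝ) (f : G → (H →L[ℂ] H)) : Prop where
  mem : ∀ x, f x ∈ M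
  mul : ∀ x y, ‖f (x * y) - f x * f y‖ ≤ ε
  uni : ∀ x, ‖star (f x) * f x - 1‖ ≤ ε

theorem AH.norm_le {M : VonNeumannAlgebra H} {ε : ℝ} {f : G → (H →L[ℂ] H)} (h : AH M ε f)
    (hε : ε ≤ 3) (x : G) : ‖f x‖ ≤ 2 := by
  have h1 : ‖star (f x) * f x‖ ≤ 4 := by
    calc ‖star (f x) * f x‖ = ‖(star (f x) * f x - 1) + 1‖ := by congr 1; abel
      _ ≤ ‖star (f x) * f x - 1‖ + ‖(1 : H →L[ℂ] H)‖ := norm_add_le _ _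
      _ ≤ 4 := by linarith [h.uni x, op_norm_one_le (H := H)]
  rw [CStarRing.norm_star_mul_self] at h1
  nlinarith [norm_nonneg (f x)]

/-- stability of `AH` under perturbation -/
theorem AH.perturb {M : VonNeumannAlgebra H} {ε κ : ℝ} {f g : G → (H →L[ℂ] H)} (h : AH M ε f)
    (hε : ε ≤ 3) (hκ : κ ≤ 1) (hg : ∀ x, g x ∈ M) (hfg : ∀ x, ‖g x - f x‖ ≤ κ) :
    AH M (ε + 6 * κ) g := by
  have hf := h.norm_le hε
  have hg2 : ∀ x, ‖g x‖ ≤ 3 := fun x => by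
    calc ‖g x‖ = ‖(g x - f x) + f x‖ := by congr 1; abel
      _ ≤ _ := norm_add_le _ _
      _ ≤ 3 := by linarith [hfg x, hf x]
  refine ⟨hg, fun x y => ?_, fun x => ?_⟩
  · have e : g (x * y) - g x * g y = (g (x * y) - f (x * y)) + (f (x * y) - f x * f y)
        - ((g x - f x) * g y + f x * (g y - f y)) := by noncomm_ring
    rw [e]
    have h1 : ‖(g x - f x) * g y‖ ≤ κ * 3 :=
      (norm_mul_le _ _).trans (mul_le_mul (hfg x) (hg2 y) (norm_nonneg _) ((norm_nonneg _).trans (hfg x)))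
    have h2 : ‖f x * (g y - f y)‖ ≤ 2 * κ :=
      (norm_mul_le _ _).trans (mul_le_mul (hf x) (hfg y) (norm_nonneg _) (by norm_num))
    have h3 := norm_sub_le ((g (x * y) - f (x * y)) + (f (x * y) - f x * f y))
      ((g x - f x) * g y + f x * (g y - f y))
    have h4 := norm_add_le (g (x * y) - f (x * y)) (f (x * y) - f x * f y)
    have h5 := norm_add_le ((g x - f x) * g y) (f x * (g y - f y))
    linarith [hfg (x * y), h.mul x y]
  · have e : star (g x) * g x - 1 = (star (g x - f x) * g x + star (f x) * (g x - f x)) +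
        (star (f x) * f x - 1) := by rw [star_sub]; noncomm_ring
    rw [e]
    have h1 : ‖star (g x - f x) * g x‖ ≤ κ * 3 :=
      (norm_mul_le _ _).trans (mul_le_mul (by rw [norm_star]; exact hfg x) (hg2 x) (norm_nonneg _)
        ((norm_nonneg _).trans (hfg x)))
    have h2 : ‖star (f x) * (g x - f x)‖ ≤ 2 * κ :=
      (norm_mul_le _ _).trans (mul_le_mul (by rw [norm_star]; exact hf x) (hfg x) (norm_nonneg _)
        (by norm_num))
    have h3 := norm_add_le (star (g x - f x) * g x + star (f x) * (g x - f x))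
      (star (f x) * f x - 1)
    have h4 := norm_add_le (star (g x - f x) * g x) (star (f x) * (g x - f x))
    linarith [h.uni x, (norm_nonneg _).trans (hfg x)]

variable [TopologicalSpace G] [IsTopologicalGroup G]

def UC (f : G → (H →L[ℂ] H)) : Prop :=
  ∀ η : ℝ, 0 < η → ∃ V ∈ 𝓝 (1 : G), ∀ u, ∀ v ∈ V, ‖f (u * v) - f u‖ ≤ η

theorem UC.continuous {f : G → (H →L[ℂ] H)} (h : UC f) : Continuous f := by
  refine continuous_iff_continuousAt.2 fun u => ?_
  rw [ContinuousAt, Metric.tendsto_nhds]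
  intro η hη
  obtain ⟨V, hV, hv⟩ := h (η / 2) (by positivity)
  rw [← map_mul_left_nhds_one u, Filter.eventually_map]
  filter_upwards [hV] with v hvV
  rw [dist_eq_norm]
  linarith [hv u v hvV]

theorem bcf_star_mul (a b : G →ᵇ (H →L[ℂ] H)) : star (star a * b) = star b * a := by
  ext1 u
  show star (star (a u) * b u) = star (b u) * a u
  rw [star_mul, star_star]

theorem newton_step (m : InvMean G) (M : VonNeumannAlgebra H) {ε : ℝ} {f : G → (H →L[ℂ] H)}
    (hf : AH M ε f) (hUC : UC f) (hε : ε ≤ 1 / 7200) :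
    ∃ F : G → (H →L[ℂ] H), AH M (ε / 2) F ∧ UC F ∧ ∀ x, ‖F x - f x‖ ≤ 20 * ε := by
  have hε0 : 0 ≤ ε := (norm_nonneg _).trans (hf.uni 1)
  have hf2 := hf.norm_le (by linarith)
  let fb : G →ᵇ (H →L[ℂ] H) :=
    BoundedContinuousFunction.ofNormedAddCommGroup f hUC.continuous 2 hf2
  set D := opM m (star fb * fb) with hDdef
  have hDsa : IsSelfAdjoint D := by
    rw [IsSelfAdjoint, hDdef, ← opM_star, bcf_star_mul]
  have hDM : D ∈ M := opM_mem m _ M fun u => mul_mem (star_mem (hf.mem u)) (hf.mem u)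
  have hD1 : ‖D - 1‖ ≤ ε := by
    rw [hDdef, ← opM_const m (1 : H →L[ℂ] H), ← opM_sub]
    exact opM_norm_le m _ hε0 fun u => hf.uni u
  obtain ⟨S, hSM, hSsa, hSDS, hS1⟩ := exists_invsqrt M hDsa hDM (by linarith) hD1
  have hSn : ‖S‖ ≤ 1.01 := by
    calc ‖S‖ = ‖(S - 1) + 1‖ := by congr 1; abel
      _ ≤ ‖S - 1‖ + ‖(1 : H →L[ℂ] H)‖ := norm_add_le _ _
      _ ≤ 1.01 := by linarith [op_norm_one_le (H := H)]
  -- normalised function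
  let g : G →ᵇ (H →L[ℂ] H) := fb * BoundedContinuousFunction.const G S
  have hg : ∀ u, g u = f u * S := fun u => rfl
  have hgM : ∀ u, g u ∈ M := fun u => mul_mem (hf.mem u) hSM
  have hg3 : ∀ u, ‖g u‖ ≤ 3 := fun u => by
    calc ‖g u‖ ≤ ‖f u‖ * ‖S‖ := norm_mul_le _ _
      _ ≤ 2 * 1.01 := mul_le_mul (hf2 u) hSn (norm_nonneg _) (by norm_num)
      _ ≤ 3 := by norm_num
  have hgg : opM m (star g * g) = 1 := by
    have : star g * g = BoundedContinuousFunction.const G S * (star fb * fb) *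
        BoundedContinuousFunction.const G S := by
      ext1 u
      show star (f u * S) * (f u * S) = S * (star (f u) * f u) * S
      rw [star_mul, hSsa.star_eq]; noncomm_ring
    rw [this, opM_mul_const, opM_const_mul, hSDS]
  have hgmul : ∀ x y, ‖g (x * y) - g x * g y‖ ≤ 6 * ε := fun x y => by
    have e : g (x * y) - g x * g y = ((f (x * y) - f x * f y) + f x * (1 - S) * f y) * S := by
      rw [hg, hg, hg]; noncomm_ring
    rw [e]
    have h1 : ‖f x * (1 - S) * f y‖ ≤ 4 * ε := by
      calc ‖f x * (1 - S) * f y‖ ≤ ‖f x‖ * ‖1 - S‖ * ‖f y‖ :=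
            (norm_mul_le _ _).trans (mul_le_mul_of_nonneg_right (norm_mul_le _ _) (norm_nonneg _))
        _ ≤ 2 * ε * 2 := by
            rw [norm_sub_rev]
            gcongr
            · exact hf2 x
            · exact hf2 y
        _ = _ := by ring
    calc _ ≤ ‖(f (x * y) - f x * f y) + f x * (1 - S) * f y‖ * ‖S‖ := norm_mul_le _ _
      _ ≤ (ε + 4 * ε) * 1.01 := by
          gcongr
          exact (norm_add_le _ _).trans (add_le_add (hf.mul x y) h1)
      _ ≤ _ := by linarith
  -- translates
  let tr : G → (G →ᵇ (H →L[ℂ] H)) := fun x =>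
    g.compContinuous ⟨fun u => u * x, continuous_id.mul continuous_const⟩
  have htr : ∀ x u, tr x u = g (u * x) := fun x u => rfl
  let c : (H →L[ℂ] H) → (G →ᵇ (H →L[ℂ] H)) := fun a => BoundedContinuousFunction.const G a
  set F : G → (H →L[ℂ] H) := fun x => opM m (star g * tr x) with hF
  have hFM : ∀ x, F x ∈ M := fun x =>
    opM_mem m _ M fun u => mul_mem (star_mem (hgM u)) (hgM (u * x))
  have hFg : ∀ x, ‖F x - g x‖ ≤ 18 * ε := fun x => by
    have : F x - g x = opM m (star g * (tr x - g * c (g x))) := by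
      rw [mul_sub, opM_sub, ← mul_assoc, opM_mul_const, hgg, one_mul]
    rw [this]
    refine opM_norm_le m _ (by positivity) fun u => ?_
    calc ‖star (g u) * (g (u * x) - g u * g x)‖ ≤ ‖star (g u)‖ * ‖g (u * x) - g u * g x‖ :=
          norm_mul_le _ _
      _ ≤ 3 * (6 * ε) := by
        rw [norm_star]
        exact mul_le_mul (hg3 u) (hgmul u x) (norm_nonneg _) (by norm_num)
      _ = _ := by ring
  have hdef : ∀ u x, ‖g (u * x) - g u * F x‖ ≤ 60 * ε := fun u x => by
    have e : g (u * x) - g u * F x = (g (u * x) - g u * g x) - g u * (F x - g x) := by noncomm_ring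
    rw [e]
    calc _ ≤ ‖g (u * x) - g u * g x‖ + ‖g u * (F x - g x)‖ := norm_sub_le _ _
      _ ≤ 6 * ε + 3 * (18 * ε) := by
        gcongr
        · exact hgmul u x
        · exact (norm_mul_le _ _).trans
            (mul_le_mul (hg3 u) (hFg x) (norm_nonneg _) (by norm_num))
      _ = _ := by ring
  have hFstar : ∀ x, star (F x) = F x⁻¹ := fun x => by
    simp only [hF]
    rw [← opM_star, bcf_star_mul]
    exact (opM_inv m (star (tr x) * g) (star g * tr x⁻¹) x⁻¹ (fun u => by
      show star (g u) * g (u * x⁻¹) = star (g (u * x⁻¹ * x)) * g (u * x⁻¹)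
      rw [inv_mul_cancel_right])).symm
  have hF1 : F 1 = 1 := by
    rw [← hgg]
    simp only [hF]
    congr 2
    ext1 u
    rw [htr, mul_one]
  have key : ∀ x y, F (x * y) - F x * F y =
      opM m (star (tr x⁻¹ - g * c (F x⁻¹)) * (tr y - g * c (F y))) := fun x y => by
    have h1 : opM m (star (tr x⁻¹) * tr y) = F (x * y) := by
      simp only [hF]
      refine opM_inv m _ _ x⁻¹ fun u => ?_
      show star (g (u * x⁻¹)) * g (u * y) = star (g (u * x⁻¹)) * g (u * x⁻¹ * (x * y))
      rw [mul_assoc u x⁻¹, inv_mul_cancel_left]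
    have h2 : opM m (star (tr x⁻¹) * (g * c (F y))) = F x * F y := by
      rw [← mul_assoc, opM_mul_const]
      congr 1
      rw [← star_star (F x), hFstar x]
      simp only [hF]
      rw [← opM_star, bcf_star_mul]
    have h3 : opM m (star (g * c (F x⁻¹)) * tr y) = F x * F y := by
      have : star (g * c (F x⁻¹)) * tr y = c (F x) * (star g * tr y) := by
        ext1 u
        show star (g u * F x⁻¹) * g (u * y) = F x * (star (g u) * g (u * y))
        rw [star_mul, hFstar, inv_inv, mul_assoc]
      rw [this, opM_const_mul]
    have h4 : opM m (star (g * c (F x⁻¹)) * (g * c (F y))) = F x * F y := by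
      have : star (g * c (F x⁻¹)) * (g * c (F y)) = c (F x) * (star g * g) * c (F y) := by
        ext1 u
        show star (g u * F x⁻¹) * (g u * F y) = F x * (star (g u) * g u) * F y
        rw [star_mul, hFstar, inv_inv]; noncomm_ring
      rw [this, opM_mul_const, opM_const_mul, hgg, mul_one]
    rw [star_sub, sub_mul, mul_sub, mul_sub, opM_sub, opM_sub, opM_sub, h1, h2, h3, h4]
    abel
  have hFmul : ∀ x y, ‖F (x * y) - F x * F y‖ ≤ ε / 2 := fun x y => by
    rw [key]
    have : ‖opM m (star (tr x⁻¹ - g * c (F x⁻¹)) * (tr y - g * c (F y)))‖ ≤ (60 * ε) * (60 * ε) := by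
      refine opM_norm_le m _ (by positivity) fun u => ?_
      calc ‖star (g (u * x⁻¹) - g u * F x⁻¹) * (g (u * y) - g u * F y)‖
          ≤ ‖star (g (u * x⁻¹) - g u * F x⁻¹)‖ * ‖(g (u * y) - g u * F y)‖ := norm_mul_le _ _
        _ ≤ (60 * ε) * (60 * ε) := by
          rw [norm_star]
          exact mul_le_mul (hdef _ _) (hdef _ _) (norm_nonneg _) (by positivity)
    nlinarith
  refine ⟨F, ⟨hFM, hFmul, fun x => ?_⟩, ?_, fun x => ?_⟩
  · have := hFmul x⁻¹ x
    rw [inv_mul_cancel, hF1, ← hFstar, norm_sub_rev] at this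
    exact this
  · intro η hη
    obtain ⟨V, hV, hv⟩ := hUC (η / 4) (by positivity)
    refine ⟨V, hV, fun x v hvV => ?_⟩
    have : F (x * v) - F x = opM m (star g * (tr (x * v) - tr x)) := by
      rw [mul_sub, opM_sub]
    rw [this]
    refine opM_norm_le m _ hη.le fun u => ?_
    have h1 : ‖g (u * (x * v)) - g (u * x)‖ ≤ η / 4 * 1.01 := by
      rw [hg, hg, ← sub_mul]
      refine (norm_mul_le _ _).trans (mul_le_mul ?_ hSn (norm_nonneg _) (by positivity))
      rw [← mul_assoc]
      exact hv (u * x) v hvV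
    calc ‖star (g u) * (g (u * (x * v)) - g (u * x))‖
        ≤ ‖star (g u)‖ * ‖g (u * (x * v)) - g (u * x)‖ := norm_mul_le _ _
      _ ≤ 3 * (η / 4 * 1.01) := by
        rw [norm_star]
        exact mul_le_mul (hg3 u) h1 (norm_nonneg _) (by norm_num)
      _ ≤ η := by linarith
  · have h1 : ‖g x - f x‖ ≤ 2 * ε := by
      have : g x - f x = f x * (S - 1) := by rw [hg]; noncomm_ring
      rw [this]
      exact (norm_mul_le _ _).trans (mul_le_mul (hf2 x) hS1 (norm_nonneg _) (by norm_num))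
    calc ‖F x - f x‖ = ‖(F x - g x) + (g x - f x)‖ := by congr 1; abel
      _ ≤ _ := norm_add_le _ _
      _ ≤ _ := by linarith [hFg x]

/-- exact unitary representation in M -/
structure Rep (M : VonNeumannAlgebra H) (f : G → (H →L[ℂ] H)) : Prop where
  mem : ∀ x, f x ∈ M
  mul : ∀ x y, f (x * y) = f x * f y
  uni : ∀ x, star (f x) * f x = 1

theorem newton (m : InvMean G) (M : VonNeumannAlgebra H) {ε : ℝ} {f : G → (H →L[ℂ] H)}
    (hf : AH M ε f) (hUC : UC f) (hε : ε ≤ 1 / 7200) :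
    ∃ F : G → (H →L[ℂ] H), Rep M F ∧ ∀ x, ‖F x - f x‖ ≤ 40 * ε := by
  have hε0 : 0 ≤ ε := (norm_nonneg _).trans (hf.uni 1)
  let T (n : ℕ) := {f : G → (H →L[ℂ] H) // AH M (ε / 2 ^ n) f ∧ UC f}
  have step : ∀ n (p : T n), ∃ q : T (n + 1), ∀ x, ‖q.1 x - p.1 x‖ ≤ 20 * (ε / 2 ^ n) := by
    intro n p
    have h2 : ε / 2 ^ n ≤ ε := div_le_self hε0 (one_le_pow₀ (by norm_num))
    obtain ⟨F, h1, h3, h4⟩ := newton_step m M p.2.1 p.2.2 (h2.trans hε)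
    refine ⟨⟨F, ?_, h3⟩, h4⟩
    rw [pow_succ, ← div_div]; exact h1
  choose nx hnx using step
  let s : ∀ n, T n := fun n => Nat.rec (motive := T) ⟨f, by simpa using hf, hUC⟩ (fun n p => nx n p) n
  have hs : ∀ n x, dist ((s n).1 x) ((s (n + 1)).1 x) ≤ (40 * ε) / 2 / 2 ^ n := fun n x => by
    rw [dist_comm, dist_eq_norm]
    refine (hnx n (s n) x).trans (le_of_eq ?_)
    ring
  have hc : ∀ x, ∃ l, Tendsto (fun n => (s n).1 x) atTop (𝓝 l) := fun x =>
    cauchySeq_tendsto_of_complete (cauchySeq_of_le_geometric_two (hs · x))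
  choose F hF using hc
  have hz : Tendsto (fun n : ℕ => ε / 2 ^ n) atTop (𝓝 0) := by
    have := (tendsto_pow_atTop_nhds_zero_of_lt_one (r := (1 / 2 : ℝ)) (by norm_num) (by norm_num)).const_mul ε
    simpa [div_eq_mul_inv] using this
  refine ⟨F, ⟨fun x => ?_, fun x y => ?_, fun x => ?_⟩, fun x => ?_⟩
  · exact (vN_isClosed M).mem_of_tendsto (hF x) (Eventually.of_forall fun n => (s n).2.1.mem x)
  · have h1 := ((hF (x * y)).sub ((hF x).mul (hF y))).norm
    have := le_of_tendsto_of_tendsto' h1 hz (fun n => (s n).2.1.mul x y)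
    exact sub_eq_zero.1 (norm_le_zero_iff.1 this)
  · have h1 := ((((hF x).star).mul (hF x)).sub_const 1).norm
    have := le_of_tendsto_of_tendsto' h1 hz (fun n => (s n).2.1.uni x)
    exact sub_eq_zero.1 (norm_le_zero_iff.1 this)
  · have := dist_le_of_le_geometric_two_of_tendsto₀ (hs · x) (hF x)
    rw [dist_comm, dist_eq_norm] at this
    exact this

end newton
end UlamAF


open scoped BoundedContinuousFunction InnerProductSpace ComplexStarModule
open Filter Topology
set_option linter.unusedSectionVars false
namespace UlamAF

section powers
variable {H : Type*} [NormedAddCommGroup H] [InnerProductSpace ℂ H] [CompleteSpace H]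

theorem power_bound {w : H →L[ℂ] H} {K : ℕ} (hK : 1 ≤ K)
    (h : ∀ k, k ≤ K → ‖w ^ k - 1‖ ≤ 1 / 2) : ‖w - 1‖ ≤ 1 / K := by
  have hK0 : (0 : ℝ) < K := by exact_mod_cast hK
  have e : (K : ℂ) • (w - 1) = (w ^ K - 1) - (w - 1) * ∑ j ∈ Finset.range K, (w ^ j - 1) := by
    rw [Finset.sum_sub_distrib, mul_sub, mul_geom_sum, Finset.sum_const, Finset.card_range,
      sub_sub_cancel, ← Nat.cast_smul_eq_nsmul ℂ, mul_smul_comm, mul_one]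
  have h1 : ‖∑ j ∈ Finset.range K, (w ^ j - 1)‖ ≤ K * (1 / 2) := by
    have := norm_sum_le_of_le (Finset.range K) (f := fun j => w ^ j - 1) (n := fun _ => (1 / 2 : ℝ))
      (fun j hj => h j (Finset.mem_range.1 hj).le)
    simpa using this
  have h2 : ‖(K : ℂ) • (w - 1)‖ ≤ 1 / 2 + ‖w - 1‖ * (K * (1 / 2)) := by
    rw [e]
    refine (norm_sub_le _ _).trans (add_le_add (h K le_rfl) ((norm_mul_le _ _).trans ?_))
    gcongr
  rw [norm_smul, Complex.norm_natCast] at h2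
  rw [le_div_iff₀ hK0]
  nlinarith

theorem eq_one_of_powers {w : H →L[ℂ] H} (h : ∀ k : ℕ, ‖w ^ k - 1‖ ≤ 1 / 2) : w = 1 := by
  have : ∀ n : ℕ, ‖w - 1‖ ≤ 1 / ((n : ℝ) + 1) := fun n => by
    have := power_bound (w := w) (K := n + 1) (by omega) (fun k _ => h k)
    simpa using this
  have h0 : ‖w - 1‖ ≤ 0 :=
    ge_of_tendsto' tendsto_one_div_add_atTop_nhds_zero_nat this
  exact sub_eq_zero.1 (norm_le_zero_iff.1 h0)

variable {G : Type*} [Group G] {M : VonNeumannAlgebra H} {f : G → (H →L[ℂ] H)}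

theorem Rep.one (h : Rep M f) : f 1 = 1 := by
  have h1 := h.uni 1
  have h2 : f 1 = f 1 * f 1 := by rw [← h.mul, mul_one]
  calc f 1 = (star (f 1) * f 1) * f 1 := by rw [h1, one_mul]
    _ = star (f 1) * (f 1 * f 1) := mul_assoc _ _ _
    _ = 1 := by rw [← h2, h1]

theorem Rep.star_eq (h : Rep M f) (x : G) : star (f x) = f x⁻¹ := by
  calc star (f x) = star (f x) * (f x * f x⁻¹) := by
        rw [← h.mul, mul_inv_cancel, h.one, mul_one]
    _ = (star (f x) * f x) * f x⁻¹ := (mul_assoc _ _ _).symm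
    _ = f x⁻¹ := by rw [h.uni, one_mul]

theorem Rep.norm_le (h : Rep M f) (x : G) : ‖f x‖ ≤ 1 := by
  have h1 : ‖f x‖ * ‖f x‖ ≤ 1 := by
    rw [← CStarRing.norm_star_mul_self, h.uni]; exact op_norm_one_le
  nlinarith [norm_nonneg (f x)]

theorem Rep.pow (h : Rep M f) (x : G) (k : ℕ) : f (x ^ k) = f x ^ k := by
  induction k with
  | zero => rw [pow_zero, pow_zero, h.one]
  | succ n ih => rw [pow_succ, pow_succ, h.mul, ih]

theorem Rep.lip (h : Rep M f) (l : G → ℝ) (hl : ∀ v, 0 ≤ l v)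
    (hp : ∀ v (k : ℕ), l (v ^ k) ≤ k * l v) (h2 : ∀ v, l v ≤ 1 / 4 → ‖f v - 1‖ ≤ 1 / 2) (v : G) :
    ‖f v - 1‖ ≤ 8 * l v := by
  rcases (hl v).eq_or_lt with h0 | h0
  · have : f v = 1 := eq_one_of_powers fun k => by
      rw [← h.pow]
      refine h2 _ ((hp v k).trans ?_)
      rw [← h0]; norm_num
    rw [this, ← h0]; simp
  · rcases lt_or_ge (1 / 4) (l v) with h3 | h3
    · calc ‖f v - 1‖ ≤ ‖f v‖ + ‖(1 : H →L[ℂ] H)‖ := norm_sub_le _ _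
        _ ≤ 1 + 1 := add_le_add (h.norm_le v) op_norm_one_le
        _ ≤ _ := by linarith
    · have hx : 1 ≤ 1 / (4 * l v) := by rw [le_div_iff₀ (by positivity)]; linarith
      have hK : 1 ≤ ⌊1 / (4 * l v)⌋₊ := (Nat.one_le_floor_iff _).2 hx
      have hK1 : (⌊1 / (4 * l v)⌋₊ : ℝ) ≤ 1 / (4 * l v) := Nat.floor_le (by positivity)
      have hK2 : 1 / (4 * l v) < (⌊1 / (4 * l v)⌋₊ : ℝ) + 1 := Nat.lt_floor_add_one _
      have hK3 : (1 : ℝ) ≤ (⌊1 / (4 * l v)⌋₊ : ℝ) := by exact_mod_cast hK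
      generalize ⌊1 / (4 * l v)⌋₊ = K at *
      have hKl : (K : ℝ) * (4 * l v) ≤ 1 := (le_div_iff₀ (by positivity)).1 hK1
      refine (power_bound hK fun k hk => ?_).trans ?_
      · rw [← h.pow]
        refine h2 _ ((hp v k).trans ?_)
        have : (k : ℝ) ≤ K := by exact_mod_cast hk
        nlinarith
      · rw [div_lt_iff₀ (by positivity)] at hK2
        rw [div_le_iff₀ (by positivity)]
        nlinarith

end powers
end UlamAF


open scoped BoundedContinuousFunction InnerProductSpace ComplexStarModule
open Filter Topology
set_option linter.unusedSectionVars false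
namespace UlamAF

section setup
variable {H : Type*} [NormedAddCommGroup H] [InnerProductSpace ℂ H] [CompleteSpace H]
variable {A : Type*} [CStarAlgebra A]

theorem norm_one_le_A : ‖(1 : A)‖ ≤ 1 := by
  have h : ‖(1 : A)‖ * ‖(1 : A)‖ = ‖(1 : A)‖ := by
    rw [← CStarRing.norm_star_mul_self]; simp
  nlinarith [norm_nonneg (1 : A)]

theorem norm_unitary_le (u : unitary A) : ‖(u : A)‖ ≤ 1 := by
  have h : ‖(u : A)‖ * ‖(u : A)‖ ≤ 1 := by
    rw [← CStarRing.norm_star_mul_self, Unitary.coe_star_mul_self]; exact norm_one_le_A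
  nlinarith [norm_nonneg (u : A)]

/-- the unitised map -/
noncomputable def th (φ : A → (H →L[ℂ] H)) (x : A) : H →L[ℂ] H := φ x + (1 - φ 1)

variable {φ : A → (H →L[ℂ] H)} {δ : ℝ} {M : VonNeumannAlgebra H}

theorem th_one : th φ 1 = 1 := by simp [th]

theorem th_mem (hM : ∀ a, φ a ∈ M) (x : A) : th φ x ∈ M :=
  add_mem (hM x) (sub_mem (one_mem M) (hM 1))

theorem delta_nonneg (h : IsApproxStarHom δ φ) : 0 ≤ δ := by
  have := h.1 0 0 (by simp) (by simp)
  exact (norm_nonneg _).trans this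

theorem th_mul (h : IsApproxStarHom δ φ) {x y : A} (hx : ‖x‖ ≤ 1) (hy : ‖y‖ ≤ 1) :
    ‖th φ (x * y) - th φ x * th φ y‖ ≤ 4 * δ := by
  have h1 := h.2.2.1 x y hx hy
  have h2 := h.2.2.1 x 1 hx norm_one_le_A
  have h3 := h.2.2.1 1 y norm_one_le_A hy
  have h4 := h.2.2.1 1 1 (norm_one_le_A (A := A)) norm_one_le_A
  rw [mul_one] at h2 h4
  rw [one_mul] at h3
  have e : th φ (x * y) - th φ x * th φ y = (φ (x * y) - φ x * φ y) - (φ x - φ x * φ 1)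
      - (φ y - φ 1 * φ y) + (φ 1 - φ 1 * φ 1) := by
    simp only [th]; noncomm_ring
  rw [e]
  refine (norm_add_le _ _).trans ?_
  have := norm_sub_le (φ (x * y) - φ x * φ y - (φ x - φ x * φ 1)) (φ y - φ 1 * φ y)
  have := norm_sub_le (φ (x * y) - φ x * φ y) (φ x - φ x * φ 1)
  linarith

theorem th_star (h : IsApproxStarHom δ φ) {x : A} (hx : ‖x‖ ≤ 1) :
    ‖th φ (star x) - star (th φ x)‖ ≤ 2 * δ := by
  have h1 := h.2.2.2.1 x hx
  have h2 := h.2.2.2.1 1 (norm_one_le_A (A := A))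
  rw [star_one] at h2
  have e : th φ (star x) - star (th φ x) = (φ (star x) - star (φ x)) - (φ 1 - star (φ 1)) := by
    simp only [th, star_add, star_sub, star_one]; abel
  rw [e]
  refine (norm_sub_le _ _).trans ?_
  linarith

theorem th_norm (h : IsApproxStarHom δ φ) {x : A} (hx : ‖x‖ ≤ 1) :
    ‖th φ x‖ ≤ 3 + 2 * δ := by
  have h1 := h.2.2.2.2 x hx
  have h2 := h.2.2.2.2 1 (norm_one_le_A (A := A))
  have := norm_add_le (φ x) (1 - φ 1)
  have := norm_sub_le 1 (φ 1)
  have := op_norm_one_le (H := H)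
  simp only [th]
  linarith

theorem phi_small (h : IsApproxStarHom δ φ) {z : A} (hz : ‖z‖ ≤ 1) :
    ‖φ z‖ ≤ δ + ‖z‖ * (1 + δ) := by
  have hz' : ‖((‖z‖⁻¹ : ℝ) : ℂ) • z‖ ≤ 1 := by
    rw [norm_smul, Complex.norm_real, norm_inv, norm_norm]
    exact inv_mul_le_one
  have h1 := h.2.1 (((‖z‖⁻¹ : ℝ) : ℂ) • z) ((‖z‖ : ℝ) : ℂ) hz' (by simpa using hz)
  have e : ((‖z‖ : ℝ) : ℂ) • ((‖z‖⁻¹ : ℝ) : ℂ) • z = z := by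
    rcases eq_or_ne z 0 with rfl | h0
    · simp
    · rw [smul_smul, ← Complex.ofReal_mul, mul_inv_cancel₀ (norm_ne_zero_iff.2 h0),
        Complex.ofReal_one, one_smul]
  rw [e] at h1
  have h2 := h.2.2.2.2 _ hz'
  have h3 : ‖((‖z‖ : ℝ) : ℂ) • φ (((‖z‖⁻¹ : ℝ) : ℂ) • z)‖ ≤ ‖z‖ * (1 + δ) := by
    rw [norm_smul, Complex.norm_real, norm_norm]
    gcongr
  have := norm_sub_norm_le (φ z) (((‖z‖ : ℝ) : ℂ) • φ (((‖z‖⁻¹ : ℝ) : ℂ) • z))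
  linarith

theorem phi_cont (h : IsApproxStarHom δ φ) {x y : A} (hy : ‖y‖ ≤ 1)
    (hxy : ‖x - y‖ ≤ 1) : ‖φ x - φ y‖ ≤ 2 * δ + ‖x - y‖ * (1 + δ) := by
  have h1 := h.1 (x - y) y hxy hy
  rw [sub_add_cancel] at h1
  have h2 := phi_small h hxy
  have e : φ x - φ y = (φ x - φ (x - y) - φ y) + φ (x - y) := by abel
  rw [e]
  refine (norm_add_le _ _).trans ?_
  linarith

theorem th_cont (h : IsApproxStarHom δ φ) {x y : A} (hy : ‖y‖ ≤ 1)
    (hxy : ‖x - y‖ ≤ 1) : ‖th φ x - th φ y‖ ≤ 2 * δ + ‖x - y‖ * (1 + δ) := by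
  have := phi_cont h hy hxy
  simpa [th] using this

theorem th_AH (hM : ∀ a, φ a ∈ M) (h : IsApproxStarHom δ φ) (hδ : δ ≤ 1 / 2)
    (G : Subgroup (unitary A)) : AH M (12 * δ) (fun u : G => th φ ((u : unitary A) : A)) where
  mem x := th_mem hM _
  mul x y := by
    have := th_mul h (norm_unitary_le (x : unitary A)) (norm_unitary_le (y : unitary A))
    have h0 := delta_nonneg h
    refine le_trans ?_ (this.trans (by linarith))
    exact le_of_eq rfl
  uni x := by
    set a : A := ((x : unitary A) : A) with ha
    have hx : ‖a‖ ≤ 1 := norm_unitary_le (x : unitary A)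
    have hs : ‖star a‖ ≤ 1 := by rwa [norm_star]
    have h1 := th_mul h hs hx
    have e1 : star a * a = 1 := Unitary.coe_star_mul_self _
    rw [e1, th_one] at h1
    have h2 := th_star h hx
    have h3 := th_norm h hx
    have h0 := delta_nonneg h
    have e : star (th φ a) * th φ a - 1 =
      -((th φ (star a) - star (th φ a)) * th φ a + (1 - th φ (star a) * th φ a)) := by noncomm_ring
    show ‖star (th φ a) * th φ a - 1‖ ≤ _
    rw [e, norm_neg]
    refine (norm_add_le _ _).trans ?_
    have h4 : ‖(th φ (star a) - star (th φ a)) * th φ a‖ ≤ (2 * δ) * 4 :=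
      (norm_mul_le _ _).trans (mul_le_mul h2 (by linarith) (norm_nonneg _) (by linarith))
    linarith

theorem unitary_pow_sub (u : unitary A) (k : ℕ) : ‖(u : A) ^ k - 1‖ ≤ k * ‖(u : A) - 1‖ := by
  induction k with
  | zero => simp
  | succ n ih =>
    have e : (u : A) ^ (n + 1) - 1 = ((u : A) ^ n - 1) * u + ((u : A) - 1) := by
      rw [pow_succ]; noncomm_ring
    rw [e]
    refine (norm_add_le _ _).trans ?_
    have := (norm_mul_le ((u : A) ^ n - 1) u).trans
      (mul_le_of_le_one_right (norm_nonneg _) (norm_unitary_le u))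
    push_cast
    linarith

theorem rep_lip (h : IsApproxStarHom δ φ) (hδ : δ ≤ 1 / 100)
    {G : Subgroup (unitary A)} {π : G → (H →L[ℂ] H)} (hπ : Rep M π)
    (hc : ∀ u : G, ‖π u - th φ ((u : unitary A) : A)‖ ≤ 1 / 10) (u v : G) :
    ‖π u - π v‖ ≤ 8 * ‖((u : unitary A) : A) - ((v : unitary A) : A)‖ := by
  have key := hπ.lip (fun v => ‖((v : unitary A) : A) - 1‖) (fun v => norm_nonneg _)
    (fun v k => by
      have := unitary_pow_sub (v : unitary A) k
      simpa using this)
    (fun v hv => by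
      have h1 := th_cont h (x := ((v : unitary A) : A)) (y := 1) norm_one_le_A (by linarith)
      rw [th_one] at h1
      have h2 := norm_add_le (π v - th φ ((v : unitary A) : A)) (th φ ((v : unitary A) : A) - 1)
      rw [sub_add_sub_cancel] at h2
      have h3 := hc v
      have h0 := delta_nonneg h
      nlinarith)
  have e : π u - π v = (π (u * v⁻¹) - 1) * π v := by
    rw [sub_mul, ← hπ.mul, inv_mul_cancel_right, one_mul]
  rw [e]
  refine (norm_mul_le _ _).trans ((mul_le_of_le_one_right (norm_nonneg _) (hπ.norm_le v)).trans
    ((key (u * v⁻¹)).trans ?_))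
  have e2 : (((u * v⁻¹ : G) : unitary A) : A) - 1
      = (((u : unitary A) : A) - ((v : unitary A) : A)) * ((v⁻¹ : unitary A) : A) := by
    rw [sub_mul]
    congr 1
    rw [← Submonoid.coe_mul, mul_inv_cancel]; rfl
  simp only [e2]
  have := (norm_mul_le (((u : unitary A) : A) - ((v : unitary A) : A)) ((v⁻¹ : unitary A) : A)).trans
      (mul_le_of_le_one_right (norm_nonneg _) (norm_unitary_le _))
  linarith

end setup
end UlamAF


open scoped BoundedContinuousFunction InnerProductSpace ComplexStarModule
open Filter Topology
set_option linter.unusedSectionVars false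
namespace UlamAF

section means

open MeasureTheory in
theorem compact_mean (G : Type*) [Group G] [TopologicalSpace G] [IsTopologicalGroup G]
    [CompactSpace G] [T2Space G] : Nonempty (InvMean G) := by
  let _ : MeasurableSpace G := borel G
  have : BorelSpace G := ⟨rfl⟩
  let μ : Measure G := Measure.haarMeasure ⊤
  have : IsProbabilityMeasure μ := ⟨by
    have := Measure.haarMeasure_self (K₀ := (⊤ : TopologicalSpace.PositiveCompacts G))
    simpa using this⟩
  have hinteg : ∀ g : G →ᵇ ℂ, Integrable (fun u => g u⁻¹) μ := fun g =>
    Integrable.of_bound (g.continuous.comp continuous_inv).aestronglyMeasurable ‖g‖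
      (Eventually.of_forall fun u => g.norm_coe_le_norm _)
  refine ⟨⟨⟨⟨fun g => ∫ u, g u⁻¹ ∂μ, fun f g => integral_add (hinteg f) (hinteg g)⟩,
    fun c g => integral_const_mul c _⟩, fun g => ?_, ?_, fun g g' x h => ?_, fun g => ?_⟩⟩
  · show ‖∫ u, g u⁻¹ ∂μ‖ ≤ ‖g‖
    have := norm_integral_le_of_norm_le_const (μ := μ) (f := fun u => g u⁻¹) (C := ‖g‖)
      (Eventually.of_forall fun u => g.norm_coe_le_norm _)
    simpa using this
  · show ∫ u, (1 : G →ᵇ ℂ) u⁻¹ ∂μ = 1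
    simp
  · show ∫ u, g' u⁻¹ ∂μ = ∫ u, g u⁻¹ ∂μ
    rw [← integral_mul_left_eq_self (fun u => g u⁻¹) x⁻¹]
    congr 1
    ext u
    rw [h, mul_inv_rev, inv_inv]
  · show ∫ u, star g u⁻¹ ∂μ = star (∫ u, g u⁻¹ ∂μ)
    exact integral_conj

theorem exists_lim_bdd {ι : Type*} (U : Ultrafilter ι) (c : ι → ℂ) (K : ℝ) (h : ∀ i, ‖c i‖ ≤ K) :
    ∃ l, Tendsto c U (𝓝 l) := by
  have hc : IsCompact (Metric.closedBall (0 : ℂ) K) := isCompact_closedBall _ _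
  obtain ⟨l, -, hl⟩ := hc.ultrafilter_le_nhds (U.map c) (by
    rw [le_principal_iff]
    exact Filter.mem_map.2 (Eventually.of_forall fun i => by simpa using h i))
  exact ⟨l, hl⟩

theorem directed_mean {G : Type*} [Group G] [TopologicalSpace G] {ι : Type*}
    (U : Ultrafilter ι) (Gi : ι → Type*) [∀ i, Group (Gi i)] [∀ i, TopologicalSpace (Gi i)]
    (j : ∀ i, Gi i →* G) (hj : ∀ i, Continuous (j i)) (m : ∀ i, InvMean (Gi i))
    (hU : ∀ x, ∀ᶠ i in U, x ∈ Set.range (j i)) : Nonempty (InvMean G) := by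
  let r : ∀ i, (G →ᵇ ℂ) → (Gi i →ᵇ ℂ) := fun i g => g.compContinuous ⟨j i, hj i⟩
  have hr : ∀ i g, ‖r i g‖ ≤ ‖g‖ := fun i g =>
    (BoundedContinuousFunction.norm_le (norm_nonneg _)).2 fun u => g.norm_coe_le_norm _
  have hex : ∀ g, ∃ l, Tendsto (fun i => (m i).m (r i g)) U (𝓝 l) := fun g =>
    exists_lim_bdd U _ ‖g‖ fun i => ((m i).bound _).trans (hr i g)
  choose l hl using hex
  refine ⟨⟨⟨⟨l, fun f g => ?_⟩, fun c g => ?_⟩, fun g => ?_, ?_, fun g g' x h => ?_, fun g => ?_⟩⟩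
  · refine tendsto_nhds_unique (hl (f + g)) (((hl f).add (hl g)).congr fun i => ?_)
    rw [← map_add]; rfl
  · refine tendsto_nhds_unique (hl (c • g)) (((hl g).const_mul c).congr fun i => ?_)
    rw [← smul_eq_mul, ← map_smul]; rfl
  · exact le_of_tendsto (hl g).norm (Eventually.of_forall fun i => ((m i).bound _).trans (hr i g))
  · refine tendsto_nhds_unique (hl 1) (tendsto_const_nhds.congr fun i => ?_)
    exact ((m i).one).symm
  · refine tendsto_nhds_unique (hl g') ((hl g).congr' ?_)
    filter_upwards [hU x] with i hi
    obtain ⟨y, rfl⟩ := hi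
    refine ((m i).inv (r i g) (r i g') y fun u => ?_).symm
    show g' (j i u) = g (j i (u * y))
    rw [h, map_mul (j i)]
  · refine tendsto_nhds_unique (hl (star g)) ((hl g).star.congr fun i => ?_)
    exact ((m i).star _).symm

variable {A : Type*} [CStarAlgebra A]

/-- unitaries in a star-subalgebra -/
def US (S : StarSubalgebra ℂ A) : Subgroup (unitary A) where
  carrier := {u | (u : A) ∈ S}
  mul_mem' := fun {a b} ha hb => by
    show ((a * b : unitary A) : A) ∈ S
    rw [Submonoid.coe_mul]; exact mul_mem ha hb
  one_mem' := one_mem S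
  inv_mem' := fun {a} ha => star_mem (s := S) ha

theorem US_mono {S T : StarSubalgebra ℂ A} (h : S ≤ T) : US S ≤ US T := fun _ hu => h hu

theorem US_compact (S : StarSubalgebra ℂ A) [FiniteDimensional ℂ S] : CompactSpace (US S) := by
  let f : US S → S := fun u => ⟨((u : unitary A) : A), u.2⟩
  have hf : IsInducing f := by
    have h0 : IsInducing (fun u : US S => ((u : unitary A) : A)) :=
      IsInducing.subtypeVal.comp IsInducing.subtypeVal
    exact (IsInducing.subtypeVal.of_comp_iff (f := f)).1 h0
  have : ProperSpace S := FiniteDimensional.proper ℂ S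
  rw [← isCompact_univ_iff, hf.isCompact_iff, Set.image_univ]
  have hr : Set.range f = {s : S | star (s : A) * s = 1 ∧ (s : A) * star (s : A) = 1} := by
    ext s
    constructor
    · rintro ⟨u, rfl⟩
      exact ⟨Unitary.coe_star_mul_self _, Unitary.coe_mul_star_self _⟩
    · rintro ⟨h1, h2⟩
      exact ⟨⟨⟨s, Unitary.mem_iff.2 ⟨h1, h2⟩⟩, s.2⟩, rfl⟩
  refine Metric.isCompact_of_isClosed_isBounded ?_ ?_
  · rw [hr]
    refine IsClosed.inter (isClosed_eq ?_ continuous_const) (isClosed_eq ?_ continuous_const)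
    · exact (continuous_subtype_val.star).mul continuous_subtype_val
    · exact continuous_subtype_val.mul (continuous_subtype_val.star)
  · refine (Metric.isBounded_closedBall (x := (0 : S)) (r := 1)).subset ?_
    rintro _ ⟨u, rfl⟩
    rw [mem_closedBall_zero_iff]
    exact norm_unitary_le _

example (S : StarSubalgebra ℂ A) : IsTopologicalGroup (US S) := inferInstance
example (S : StarSubalgebra ℂ A) : T2Space (US S) := inferInstance

end means
end UlamAF


open scoped BoundedContinuousFunction InnerProductSpace ComplexStarModule
open Filter Topology
set_option linter.unusedSectionVars false
namespace UlamAF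

section stages
variable {H : Type*} [NormedAddCommGroup H] [InnerProductSpace ℂ H] [CompleteSpace H]
variable {A : Type*} [CStarAlgebra A]
variable {φ : A → (H →L[ℂ] H)} {δ : ℝ} {M : VonNeumannAlgebra H}

theorem UC_of_compact {G : Type*} [Group G] [TopologicalSpace G] [IsTopologicalGroup G]
    [CompactSpace G] {f : G → (H →L[ℂ] H)} (hf : Continuous f) : UC f := by
  intro η hη
  have h := (isCompact_univ (X := G)).eventually_forall_of_forall_eventually (x₀ := (1 : G))
    (P := fun v u => ‖f (u * v) - f u‖ ≤ η) (fun u _ => by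
      have hc : Continuous fun z : G × G => ‖f (z.2 * z.1) - f z.2‖ := by fun_prop
      have ht := hc.tendsto (1, u)
      simp only [mul_one, sub_self, norm_zero] at ht
      exact ht.eventually (ge_mem_nhds hη))
  exact ⟨_, h, fun u v hv => hv u (Set.mem_univ u)⟩

theorem stage1 (hM : ∀ a, φ a ∈ M) (h : IsApproxStarHom δ φ) (hδ0 : 0 < δ) (hδ : δ ≤ 1 / 10 ^ 8)
    (S : StarSubalgebra ℂ A) [FiniteDimensional ℂ S] :
    ∃ π : US S → (H →L[ℂ] H), Rep M π ∧
      ∀ u : US S, ‖π u - th φ ((u : unitary A) : A)‖ ≤ 1444 * δ := by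
  have hcpt : CompactSpace (US S) := US_compact S
  let t : US S → Set (H →L[ℂ] H) := fun x => {b | b ∈ M ∧ ‖b - th φ ((x : unitary A) : A)‖ ≤ 4 * δ}
  have hconv : ∀ x, Convex ℝ (t x) := by
    intro x a ha b hb r s hr hs hrs
    refine ⟨?_, ?_⟩
    · have := add_mem (vN_smul_mem M (r : ℂ) ha.1) (vN_smul_mem M (s : ℂ) hb.1)
      simpa using this
    · have hc := convex_closedBall (th φ ((x : unitary A) : A)) (4 * δ)
      have := hc (mem_closedBall_iff_norm.2 ha.2) (mem_closedBall_iff_norm.2 hb.2) hr hs hrs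
      exact mem_closedBall_iff_norm.1 this
  have hloc : ∀ x, ∃ c, ∀ᶠ y in 𝓝 x, c ∈ t y := by
    intro x
    refine ⟨th φ ((x : unitary A) : A), ?_⟩
    have hc : Continuous fun y : US S => ‖((x : unitary A) : A) - ((y : unitary A) : A)‖ := by fun_prop
    have ht := hc.tendsto x
    simp only [sub_self, norm_zero] at ht
    filter_upwards [ht.eventually (ge_mem_nhds hδ0)] with y hy
    refine ⟨th_mem hM _, (th_cont h (norm_unitary_le _) (by linarith)).trans ?_⟩
    nlinarith
  obtain ⟨f, hf⟩ := exists_continuous_forall_mem_convex_of_local_const hconv hloc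
  have hAH := (th_AH hM h (by linarith) (US S)).perturb (κ := 4 * δ) (by linarith) (by linarith)
    (fun x => (hf x).1) (fun x => (hf x).2)
  obtain ⟨m⟩ := compact_mean (US S)
  obtain ⟨F, hF, hFf⟩ := newton m M hAH (UC_of_compact f.continuous) (by linarith)
  refine ⟨F, hF, fun u => ?_⟩
  have := norm_add_le (F u - f u) (f u - th φ ((u : unitary A) : A))
  rw [sub_add_sub_cancel] at this
  have h1 := hFf u
  have h2 := (hf u).2
  linarith

/-- unitaries in the union of a directed family -/
def UI (𝒮 : Set (StarSubalgebra ℂ A)) (hne : 𝒮.Nonempty) (hd : DirectedOn (· ≤ ·) 𝒮) :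
    Subgroup (unitary A) where
  carrier := {u | ∃ S ∈ 𝒮, (u : A) ∈ S}
  mul_mem' := by
    rintro a b ⟨S, hS, ha⟩ ⟨T, hT, hb⟩
    obtain ⟨R, hR, h1, h2⟩ := hd S hS T hT
    exact ⟨R, hR, (US R).mul_mem (h1 ha : a ∈ US R) (h2 hb : b ∈ US R)⟩
  one_mem' := by
    obtain ⟨S, hS⟩ := hne
    exact ⟨S, hS, one_mem S⟩
  inv_mem' := by
    rintro a ⟨S, hS, ha⟩
    exact ⟨S, hS, (US S).inv_mem (ha : a ∈ US S)⟩

theorem stage2 (hM : ∀ a, φ a ∈ M) (h : IsApproxStarHom δ φ) (hδ0 : 0 < δ) (hδ : δ ≤ 1 / 10 ^ 8)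
    (𝒮 : Set (StarSubalgebra ℂ A)) (hne : 𝒮.Nonempty) (hd : DirectedOn (· ≤ ·) 𝒮)
    (hfd : ∀ S ∈ 𝒮, FiniteDimensional ℂ S) :
    ∃ π : UI 𝒮 hne hd → (H →L[ℂ] H), Rep M π ∧
      ∀ u : UI 𝒮 hne hd, ‖π u - th φ ((u : unitary A) : A)‖ ≤ 350000 * δ := by
  classical
  have hfd' : ∀ S : 𝒮, FiniteDimensional ℂ (S : StarSubalgebra ℂ A) := fun S => hfd S.1 S.2
  have h1 := fun S : 𝒮 => stage1 hM h hδ0 hδ (S : StarSubalgebra ℂ A)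
  choose p hp hpc using h1
  have hne' : Nonempty 𝒮 := hne.to_subtype
  have hd1 : IsDirectedOrder 𝒮 := ⟨directedOn_iff_directed.1 hd⟩
  let U : Ultrafilter 𝒮 := Ultrafilter.of atTop
  have hev : ∀ u : UI 𝒮 hne hd, ∀ᶠ S : 𝒮 in U, (u : unitary A) ∈ US (S : StarSubalgebra ℂ A) := by
    rintro ⟨u, S, hS, hu⟩
    refine Ultrafilter.of_le atTop ?_
    filter_upwards [eventually_ge_atTop (⟨S, hS⟩ : 𝒮)] with T hT
    exact US_mono hT hu
  let a : unitary A → 𝒮 → (H →L[ℂ] H) := fun u S =>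
    if hu : u ∈ US (S : StarSubalgebra ℂ A) then p S ⟨u, hu⟩ else th φ (u : A)
  have haM : ∀ u S, a u S ∈ M := by
    intro u S
    simp only [a]
    split_ifs with hu
    · exact (hp S).mem _
    · exact th_mem hM _
  have hac : ∀ u S, ‖a u S - th φ (u : A)‖ ≤ 1444 * δ := by
    intro u S
    simp only [a]
    split_ifs with hu
    · exact hpc S ⟨u, hu⟩
    · rw [sub_self, norm_zero]; positivity
  have hab : ∀ u S, ‖a u S‖ ≤ 5 := by
    intro u S
    have h2 := th_norm h (norm_unitary_le u)
    have h3 := norm_add_le (a u S - th φ (u : A)) (th φ (u : A))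
    rw [sub_add_cancel] at h3
    have := hac u S
    linarith
  have hex := fun u => exists_wlim U (a u) 5 (hab u)
  choose T hT using hex
  have hTM : ∀ u, T u ∈ M := fun u => wlim_mem U (hT u) M (haM u)
  have hTc : ∀ u, ‖T u - th φ (u : A)‖ ≤ 1444 * δ := fun u =>
    wlim_norm_le U (wlim_sub U (hT u) (a' := fun _ => th φ (u : A)) (fun x y => tendsto_const_nhds))
      (by positivity) (Eventually.of_forall (hac u))
  have hTl : ∀ u v : UI 𝒮 hne hd, ‖T u - T v‖ ≤ 8 * ‖((u : unitary A) : A) - ((v : unitary A) : A)‖ := by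
    intro u v
    refine wlim_norm_le U (wlim_sub U (hT u) (hT v)) (by positivity) ?_
    filter_upwards [hev u, hev v] with S hu hv
    simp only [a, dif_pos hu, dif_pos hv]
    exact rep_lip h (by linarith) (hp S) (fun u => (hpc S u).trans (by linarith)) ⟨u, hu⟩ ⟨v, hv⟩
  let f : UI 𝒮 hne hd → (H →L[ℂ] H) := fun u => T u
  have hUC : UC f := by
    intro η hη
    have hc : Continuous fun v : UI 𝒮 hne hd => 8 * ‖((v : unitary A) : A) - 1‖ := by fun_prop
    have ht := hc.tendsto 1
    have e0 : (8 : ℝ) * ‖(((1 : UI 𝒮 hne hd) : unitary A) : A) - 1‖ = 0 := by simp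
    rw [e0] at ht
    refine ⟨_, ht.eventually (ge_mem_nhds hη), fun u v hv => ?_⟩
    refine (hTl (u * v) u).trans (le_trans ?_ hv)
    have e : (((u * v : UI 𝒮 hne hd) : unitary A) : A) - ((u : unitary A) : A)
      = ((u : unitary A) : A) * (((v : unitary A) : A) - 1) := by
      rw [mul_sub, mul_one]; rfl
    rw [e]
    have := (norm_mul_le ((u : unitary A) : A) (((v : unitary A) : A) - 1)).trans
      (mul_le_of_le_one_left (norm_nonneg _) (norm_unitary_le _))
    linarith
  have hAH : AH M (12 * δ + 6 * (1444 * δ)) f :=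
    (th_AH hM h (by linarith) (UI 𝒮 hne hd)).perturb (κ := 1444 * δ) (by linarith) (by linarith)
    (fun x => hTM x) (fun x => hTc x)
  have hm : Nonempty (InvMean (UI 𝒮 hne hd)) := by
    have hcm : ∀ S : 𝒮, Nonempty (InvMean (US (S : StarSubalgebra ℂ A))) := fun S =>
      have := US_compact (S : StarSubalgebra ℂ A)
      compact_mean _
    have hle : ∀ S : 𝒮, US (S : StarSubalgebra ℂ A) ≤ UI 𝒮 hne hd := fun S u hu => ⟨S.1, S.2, hu⟩
    refine directed_mean U (fun S : 𝒮 => US (S : StarSubalgebra ℂ A))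
      (fun S => Subgroup.inclusion (hle S)) (fun S => ?_) (fun S => (hcm S).some) fun x => ?_
    · exact continuous_inclusion (hle S)
    · filter_upwards [hev x] with S hx
      exact ⟨⟨x, hx⟩, rfl⟩
  obtain ⟨m⟩ := hm
  obtain ⟨F, hF, hFf⟩ := newton m M hAH hUC (by linarith)
  refine ⟨F, hF, fun u => ?_⟩
  have := norm_add_le (F u - f u) (f u - th φ ((u : unitary A) : A))
  rw [sub_add_sub_cancel] at this
  have h1 := hFf u
  have h2 := hTc u
  linarith

end stages
end UlamAF


open scoped BoundedContinuousFunction InnerProductSpace ComplexStarModule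
open Filter Topology
set_option linter.unusedSectionVars false
namespace UlamAF

section spectral
variable {A : Type*} [CStarAlgebra A]

theorem spec_finite {S : StarSubalgebra ℂ A} [FiniteDimensional ℂ S] {a : A} (ha : a ∈ S) :
    (spectrum ℂ a).Finite := by
  have hinteg : IsIntegral ℂ (⟨a, ha⟩ : S) := Algebra.IsIntegral.isIntegral _
  set p := minpoly ℂ (⟨a, ha⟩ : S) with hp
  have hp0 : p ≠ 0 := minpoly.ne_zero hinteg
  have h0 : Polynomial.aeval a p = 0 := by
    have h1 := minpoly.aeval ℂ (⟨a, ha⟩ : S)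
    have h2 := Polynomial.aeval_algHom_apply S.subtype.toAlgHom (⟨a, ha⟩ : S) p
    rw [← hp] at h1
    rw [h1] at h2
    simpa using h2
  refine (p.rootSet_finite ℂ).subset fun z hz => ?_
  have h1 := spectrum.subset_polynomial_aeval a p ⟨z, hz, rfl⟩
  rw [h0] at h1
  rw [Polynomial.mem_rootSet]
  refine ⟨hp0, ?_⟩
  by_contra hne
  have hz0 : spectrum ℂ (0 : A) ⊆ {0} := by
    rcases subsingleton_or_nontrivial A with h | h
    · rw [spectrum.of_subsingleton]; exact Set.empty_subset _
    · rw [spectrum.zero_eq]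
  exact hne (by simpa using hz0 h1)

theorem cfc_mem_S {S : StarSubalgebra ℂ A} [FiniteDimensional ℂ S] {a : A} (ha : a ∈ S)
    (f : ℂ → ℂ) : cfc f a ∈ S := by
  have hcl : IsClosed (S : Set A) := S.toSubalgebra.toSubmodule.closed_of_finiteDimensional
  exact StarAlgebra.elemental.le_of_mem hcl ha (cfc_mem_elemental f a)

theorem spectral {S : StarSubalgebra ℂ A} [FiniteDimensional ℂ S] {a : A} (ha : a ∈ S)
    [IsStarNormal a] : ∃ (s : Finset ℂ) (P : ℂ → A), (∀ z ∈ s, z ∈ spectrum ℂ a) ∧ (∀ z, P z ∈ S) ∧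
      (∀ z, IsStarProjection (P z)) ∧ (∀ z w, z ≠ w → P z * P w = 0) ∧ ∑ z ∈ s, P z = 1 ∧
      a = ∑ z ∈ s, z • P z := by
  classical
  have hfin := spec_finite ha
  have hc : ∀ f : ℂ → ℂ, ContinuousOn f (spectrum ℂ a) := fun f => hfin.continuousOn f
  let ind : ℂ → ℂ → ℂ := fun z w => if w = z then 1 else 0
  refine ⟨hfin.toFinset, fun z => cfc (ind z) a, fun z hz => hfin.mem_toFinset.1 hz,
    fun z => cfc_mem_S ha _, fun z => ⟨?_, ?_⟩, fun z w hzw => ?_, ?_, ?_⟩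
  · show cfc (ind z) a * cfc (ind z) a = cfc (ind z) a
    rw [← cfc_mul (ind z) (ind z) a (hc _) (hc _)]
    congr 1; ext w; simp only [ind]; split_ifs <;> simp
  · show star (cfc (ind z) a) = cfc (ind z) a
    rw [← cfc_star]
    congr 1; ext w; simp only [ind]; split_ifs <;> simp
  · show cfc (ind z) a * cfc (ind w) a = 0
    rw [← cfc_mul (ind z) (ind w) a (hc _) (hc _), ← cfc_zero ℂ a]
    congr 1; ext x; simp only [ind, Pi.zero_apply]
    split_ifs with h1 h2
    · exact absurd (h1.symm.trans h2) hzw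
    all_goals simp
  · rw [← cfc_sum ind a _ (fun i _ => hc _), ← cfc_one ℂ a]
    refine cfc_congr fun x hx => ?_
    simp [ind, hx]
  · have : ∀ z, z • cfc (ind z) a = cfc (fun w => z • ind z w) a := fun z =>
      (cfc_smul z (ind z) a (hc _)).symm
    simp only [this]
    rw [← cfc_sum (fun z w => z • ind z w) a _ (fun i _ => hc _)]
    conv_lhs => rw [← cfc_id ℂ a]
    refine cfc_congr fun x hx => ?_
    simp [ind, hx]

theorem exists_unitary_avg {S : StarSubalgebra ℂ A} [FiniteDimensional ℂ S] {a : A} (ha : a ∈ S)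
    (hsa : IsSelfAdjoint a) (hn : ‖a‖ ≤ 1) :
    ∃ u ∈ US S, a = (1 / 2 : ℂ) • ((u : A) + star (u : A)) := by
  have hfin := spec_finite ha
  have hc : ∀ f : ℂ → ℂ, ContinuousOn f (spectrum ℂ a) := fun f => hfin.continuousOn f
  have hnorm : IsStarNormal a := hsa.isStarNormal
  let f : ℂ → ℂ := fun z => (z.re : ℂ) + Complex.I * (Real.sqrt (1 - z.re ^ 2) : ℝ)
  have hre : ∀ x ∈ spectrum ℂ a, x = (x.re : ℂ) ∧ x.re ^ 2 ≤ 1 := fun x hx => by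
    refine ⟨hsa.mem_spectrum_eq_re hx, ?_⟩
    have h1 : ‖x‖ ≤ ‖a‖ := by
      rcases subsingleton_or_nontrivial A with h | h
      · rw [spectrum.of_subsingleton] at hx; exact hx.elim
      · exact spectrum.norm_le_norm_of_mem hx
    have h2 := Complex.abs_re_le_norm x
    rw [sq_le_one_iff_abs_le_one]; linarith
  have hu : cfc f a ∈ unitary A := by
    rw [cfc_unitary_iff f a hnorm (hc f)]
    intro x hx
    have h1 := Real.sq_sqrt (sub_nonneg.2 (hre x hx).2)
    apply Complex.ext
    · simp [f]; nlinarith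
    · simp [f]; ring
  refine ⟨⟨cfc f a, hu⟩, cfc_mem_S ha f, ?_⟩
  show a = (1 / 2 : ℂ) • (cfc f a + star (cfc f a))
  rw [← cfc_star, ← cfc_add a f (fun x => star (f x)) (hc _) (hc _), ← cfc_smul _ _ a (hc _)]
  conv_lhs => rw [← cfc_id ℂ a]
  refine cfc_congr fun x hx => ?_
  have := (hre x hx).1
  apply Complex.ext
  · simp [f]; ring
  · rw [this]; simp [f]

end spectral
end UlamAF


open scoped BoundedContinuousFunction InnerProductSpace ComplexStarModule
open Filter Topology
set_option linter.unusedSectionVars false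
namespace UlamAF

section uz
variable {B : Type*} [Ring B] [Algebra ℂ B]

/-- the one-parameter family `1 + (z-1) p` -/
def uz (p : B) (z : ℂ) : B := 1 + (z - 1) • p

theorem uz_one (p : B) : uz p 1 = 1 := by simp [uz]

theorem uz_mul {p : B} (hp : p * p = p) (z w : ℂ) : uz p z * uz p w = uz p (z * w) := by
  simp only [uz, mul_add, add_mul, one_mul, mul_one, smul_mul_smul_comm, hp]
  module

theorem uz_pow {p : B} (hp : p * p = p) (z : ℂ) (k : ℕ) : uz p z ^ k = uz p (z ^ k) := by
  induction k with
  | zero => simp [uz_one]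
  | succ n ih => rw [pow_succ, pow_succ, ih, uz_mul hp]

end uz

section proj
variable {H : Type*} [NormedAddCommGroup H] [InnerProductSpace ℂ H] [CompleteSpace H]
variable {A : Type*} [CStarAlgebra A]

theorem uz_star {p : A} (hp : IsStarProjection p) (z : ℂ) : star (uz p z) = uz p (star z) := by
  have h2 : star p = p := hp.isSelfAdjoint
  simp [uz, star_smul, h2]

/-- unitary elements of `𝒜` -/
def WU (𝒜 : StarSubalgebra ℂ A) : Set A := {a | a ∈ unitary A ∧ a ∈ 𝒜}

theorem conj_mul_self_of_norm {z : ℂ} (hz : ‖z‖ = 1) : star z * z = 1 := by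
  have := Complex.conj_mul' z
  rw [hz] at this
  simpa using this

theorem uz_mem {𝒜 : StarSubalgebra ℂ A} {p : A} (hp : IsStarProjection p) (hpA : p ∈ 𝒜) {z : ℂ}
    (hz : ‖z‖ = 1) : uz p z ∈ WU 𝒜 := by
  have h1 : p * p = p := hp.isIdempotentElem
  refine ⟨Unitary.mem_iff.2 ⟨?_, ?_⟩, ?_⟩
  · rw [uz_star hp, uz_mul h1, conj_mul_self_of_norm hz, uz_one]
  · rw [uz_star hp, uz_mul h1, mul_comm, conj_mul_self_of_norm hz, uz_one]
  · exact add_mem (one_mem _) (SMulMemClass.smul_mem _ hpA)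

theorem norm_proj_le {p : A} (hp : IsStarProjection p) : ‖p‖ ≤ 1 := by
  have h1 : p * p = p := hp.isIdempotentElem
  have h2 : star p = p := hp.isSelfAdjoint
  have h : ‖p‖ * ‖p‖ = ‖p‖ := by rw [← CStarRing.norm_star_mul_self, h2, h1]
  nlinarith [norm_nonneg p]

theorem isStarProjection_one_sub {p : A} (hp : IsStarProjection p) : IsStarProjection (1 - p) := hp.one_sub

/-- a unitary representation of the unitaries of `𝒜`, as a function on `A` -/
structure PR (M : VonNeumannAlgebra H) (𝒜 : StarSubalgebra ℂ A) (P : A → (H →L[ℂ] H)) : Prop where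
  mem : ∀ a ∈ WU 𝒜, P a ∈ M
  mul : ∀ a ∈ WU 𝒜, ∀ b ∈ WU 𝒜, P (a * b) = P a * P b
  one : P 1 = 1
  star : ∀ a ∈ WU 𝒜, P (star a) = star (P a)
  norm : ∀ a ∈ WU 𝒜, ‖P a‖ ≤ 1
  lip : ∀ a ∈ WU 𝒜, ∀ b ∈ WU 𝒜, ‖P a - P b‖ ≤ 8 * ‖a - b‖

/-- the projection associated to `p` -/
noncomputable def qp (P : A → (H →L[ℂ] H)) (p : A) : H →L[ℂ] H := (1 / 2 : ℂ) • (1 - P (uz p (-1)))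

variable {φ : A → (H →L[ℂ] H)} {δ κ : ℝ} {M : VonNeumannAlgebra H} {𝒜 : StarSubalgebra ℂ A}
  {P : A → (H →L[ℂ] H)}

theorem qp_proj (hP : PR M 𝒜 P) {p : A} (hp : IsStarProjection p) (hpA : p ∈ 𝒜) :
    IsStarProjection (qp P p) := by
  have hm : uz p (-1) ∈ WU 𝒜 := uz_mem hp hpA (by simp)
  have hg : P (uz p (-1)) * P (uz p (-1)) = 1 := by
    rw [← hP.mul _ hm _ hm, uz_mul hp.isIdempotentElem]
    norm_num
    rw [uz_one, hP.one]
  have hs : star (P (uz p (-1))) = P (uz p (-1)) := by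
    rw [← hP.star _ hm, uz_star hp]; simp
  constructor
  · show qp P p * qp P p = qp P p
    simp only [qp, smul_mul_smul_comm, mul_sub, sub_mul, one_mul, mul_one, hg]
    module
  · show star (qp P p) = qp P p
    simp [qp, hs]

theorem qp_mem (hP : PR M 𝒜 P) {p : A} (hp : IsStarProjection p) (hpA : p ∈ 𝒜) : qp P p ∈ M :=
  vN_smul_mem M _ (sub_mem (one_mem M) (hP.mem _ (uz_mem hp hpA (by simp))))

theorem qp_norm (hP : PR M 𝒜 P) {p : A} (hp : IsStarProjection p) (hpA : p ∈ 𝒜) :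
    ‖qp P p‖ ≤ 1 := norm_proj_le (qp_proj hP hp hpA)

theorem norm_sub_one_le {z : ℂ} (hz : ‖z‖ = 1) : ‖z - 1‖ ≤ 2 := by
  have := norm_sub_le z 1
  rw [hz, norm_one] at this
  linarith

theorem P_uz_approx (h : IsApproxStarHom δ φ)
    (hc : ∀ a ∈ WU 𝒜, ‖P a - th φ a‖ ≤ κ) {p : A} (hp : IsStarProjection p) (hpA : p ∈ 𝒜)
    {z : ℂ} (hz : ‖z‖ = 1) : ‖P (uz p z) - uz (φ p) z‖ ≤ κ + 3 * δ := by
  have hp1 := norm_proj_le hp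
  have h1p := norm_proj_le hp.one_sub
  have h1 := h.1 (1 - p) p h1p hp1
  have h2 := h.1 (1 - p) (z • p) h1p (by rw [norm_smul, hz, one_mul]; exact hp1)
  have h3 := h.2.1 p z hp1 hz.le
  rw [sub_add_cancel] at h1
  have e : 1 - p + z • p = uz p z := by simp only [uz]; module
  rw [e] at h2
  have h4 := hc _ (uz_mem hp hpA hz)
  have e2 : P (uz p z) - uz (φ p) z = (P (uz p z) - th φ (uz p z))
    + (φ (uz p z) - φ (1 - p) - φ (z • p)) + (φ (z • p) - z • φ p)
    - (φ 1 - φ (1 - p) - φ p) := by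
    simp only [th]
    rw [show uz (φ p) z = 1 + (z - 1) • φ p from rfl]
    module
  rw [e2]
  have a1 := norm_sub_le ((P (uz p z) - th φ (uz p z))
    + (φ (uz p z) - φ (1 - p) - φ (z • p)) + (φ (z • p) - z • φ p)) (φ 1 - φ (1 - p) - φ p)
  have a2 := norm_add_le ((P (uz p z) - th φ (uz p z))
    + (φ (uz p z) - φ (1 - p) - φ (z • p))) (φ (z • p) - z • φ p)
  have a3 := norm_add_le (P (uz p z) - th φ (uz p z)) (φ (uz p z) - φ (1 - p) - φ (z • p))
  linarith

theorem P_uz_near (h : IsApproxStarHom δ φ)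
    (hc : ∀ a ∈ WU 𝒜, ‖P a - th φ a‖ ≤ κ) {p : A} (hp : IsStarProjection p) (hpA : p ∈ 𝒜)
    {z : ℂ} (hz : ‖z‖ = 1) : ‖P (uz p z) - uz (qp P p) z‖ ≤ 2 * (κ + 3 * δ) := by
  have h1 := P_uz_approx h hc hp hpA hz
  have h2 := P_uz_approx h hc hp hpA (z := -1) (by simp)
  have e : P (uz p z) - uz (qp P p) z = (P (uz p z) - uz (φ p) z)
      + ((z - 1) * (1 / 2)) • (P (uz p (-1)) - uz (φ p) (-1)) := by
    rw [show uz (φ p) z = 1 + (z - 1) • φ p from rfl, show uz (φ p) (-1) = 1 + (-1 - 1 : ℂ) • φ p from rfl,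
      show uz (qp P p) z = 1 + (z - 1) • qp P p from rfl, qp]
    module
  rw [e]
  refine (norm_add_le _ _).trans ?_
  rw [norm_smul]
  have h3 : ‖(z - 1) * (1 / 2)‖ ≤ 1 := by
    rw [norm_mul]
    have := norm_sub_one_le hz
    norm_num
    linarith
  have := mul_le_mul h3 h2 (norm_nonneg _) (by norm_num)
  linarith

theorem P_uz (hP : PR M 𝒜 P) (h : IsApproxStarHom δ φ)
    (hc : ∀ a ∈ WU 𝒜, ‖P a - th φ a‖ ≤ κ) (hk : κ + 3 * δ ≤ 1 / 12)
    {p : A} (hp : IsStarProjection p) (hpA : p ∈ 𝒜)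
    {z : ℂ} (hz : ‖z‖ = 1) : P (uz p z) = uz (qp P p) z := by
  have hpp : p * p = p := hp.isIdempotentElem
  have hqq : qp P p * qp P p = qp P p := (qp_proj hP hp hpA).isIdempotentElem
  have hW : ∀ {z : ℂ}, ‖z‖ = 1 → uz p z ∈ WU 𝒜 := fun hz => uz_mem hp hpA hz
  have hpow : ∀ k : ℕ, P (uz p z) ^ k = P (uz p (z ^ k)) := by
    intro k
    induction k with
    | zero => simp [uz_one, hP.one]
    | succ n ih =>
      rw [pow_succ, pow_succ, ih, ← hP.mul _ (hW (by rw [norm_pow, hz, one_pow])) _ (hW hz), uz_mul hpp]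
  have hcomm : Commute (P (uz p z)) (uz (qp P p) (star z)) := by
    have h1 : Commute (P (uz p z)) (P (uz p (-1))) := by
      have hm : ‖(-1 : ℂ)‖ = 1 := by simp
      show _ * _ = _ * _
      rw [← hP.mul _ (hW hz) _ (hW hm), ← hP.mul _ (hW hm) _ (hW hz), uz_mul hpp, uz_mul hpp, mul_comm]
    have h2 : Commute (P (uz p z)) (qp P p) := ((Commute.one_right _).sub_right h1).smul_right _
    exact (Commute.one_right _).add_right (h2.smul_right _)
  have hw : P (uz p z) * uz (qp P p) (star z) = 1 := by
    refine eq_one_of_powers fun k => ?_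
    rw [hcomm.mul_pow, hpow, uz_pow hqq]
    have hzk : ‖z ^ k‖ = 1 := by rw [norm_pow, hz, one_pow]
    rw [← star_pow]
    generalize z ^ k = y at hzk
    have e : P (uz p y) * uz (qp P p) (star y) - 1 =
        (P (uz p y) - uz (qp P p) y) * uz (qp P p) (star y) := by
      rw [sub_mul, uz_mul hqq, mul_comm y, conj_mul_self_of_norm hzk, uz_one]
    rw [e]
    have h1 := P_uz_near h hc hp hpA hzk
    have h2 : ‖uz (qp P p) (star y)‖ ≤ 3 := by
      refine (norm_add_le _ _).trans ?_
      rw [norm_smul]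
      have h3 := norm_sub_one_le (z := star y) (by rw [norm_star, hzk])
      have h4 := mul_le_mul h3 (qp_norm hP hp hpA) (norm_nonneg _) (by norm_num)
      have := op_norm_one_le (H := H)
      linarith
    have := (norm_mul_le (P (uz p y) - uz (qp P p) y) (uz (qp P p) (star y))).trans
      (mul_le_mul h1 h2 (norm_nonneg _) ((norm_nonneg _).trans h1))
    linarith
  calc P (uz p z) = P (uz p z) * (uz (qp P p) (star z) * uz (qp P p) z) := by
        rw [uz_mul hqq, conj_mul_self_of_norm hz, uz_one, mul_one]
    _ = uz (qp P p) z := by rw [← mul_assoc, hw, one_mul]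

end proj
end UlamAF


open scoped BoundedContinuousFunction InnerProductSpace ComplexStarModule
open Filter Topology
set_option linter.unusedSectionVars false
namespace UlamAF

section deriv
variable {H : Type*} [NormedAddCommGroup H] [InnerProductSpace ℂ H] [CompleteSpace H]
variable {A : Type*} [CStarAlgebra A]

/-- `r` is the derivative at `1` of `P` in the direction `h` -/
def DD (𝒜 : StarSubalgebra ℂ A) (P : A → (H →L[ℂ] H)) (h : A) (r : H →L[ℂ] H) : Prop :=
  ∃ V : ℝ → A, (∀ t, V t ∈ WU 𝒜) ∧ V 0 = 1 ∧ HasDerivAt V h 0 ∧ HasDerivAt (fun t => P (V t)) r 0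

variable {φ : A → (H →L[ℂ] H)} {δ κ : ℝ} {M : VonNeumannAlgebra H} {𝒜 : StarSubalgebra ℂ A}
  {P : A → (H →L[ℂ] H)}

theorem WU_one : (1 : A) ∈ WU 𝒜 := ⟨one_mem _, one_mem _⟩

theorem WU_mul {a b : A} (ha : a ∈ WU 𝒜) (hb : b ∈ WU 𝒜) : a * b ∈ WU 𝒜 :=
  ⟨mul_mem ha.1 hb.1, mul_mem ha.2 hb.2⟩

theorem WU_star {a : A} (ha : a ∈ WU 𝒜) : star a ∈ WU 𝒜 :=
  ⟨Unitary.star_mem ha.1, star_mem ha.2⟩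

theorem DD.bound (hP : PR M 𝒜 P) {h h' : A} {r r' : H →L[ℂ] H} (h1 : DD 𝒜 P h r)
    (h2 : DD 𝒜 P h' r') : ‖r - r'‖ ≤ 8 * ‖h - h'‖ := by
  obtain ⟨V, hV, hV0, hVd, hVP⟩ := h1
  obtain ⟨W, hW, hW0, hWd, hWP⟩ := h2
  have d1 := (hVP.sub hWP).tendsto_slope.norm
  have d2 := ((hVd.sub hWd).tendsto_slope.norm).const_mul 8
  refine le_of_tendsto_of_tendsto' d1 d2 fun t => ?_
  simp only [slope, vsub_eq_sub, sub_zero, norm_smul, Pi.sub_apply, hV0, hW0, sub_self]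
  have := hP.lip _ (hV t) _ (hW t)
  have h3 := mul_le_mul_of_nonneg_left this (norm_nonneg (t⁻¹))
  linarith

theorem DD.unique (hP : PR M 𝒜 P) {h : A} {r r' : H →L[ℂ] H} (h1 : DD 𝒜 P h r)
    (h2 : DD 𝒜 P h r') : r = r' := by
  have := h1.bound hP h2
  simp only [sub_self, norm_zero, mul_zero] at this
  exact sub_eq_zero.1 (norm_le_zero_iff.1 this)

theorem DD.zero (hP : PR M 𝒜 P) : DD 𝒜 P 0 0 :=
  ⟨fun _ => 1, fun _ => WU_one, rfl, hasDerivAt_const _ _, hasDerivAt_const _ _⟩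

theorem DD.norm_le (hP : PR M 𝒜 P) {h : A} {r : H →L[ℂ] H} (h1 : DD 𝒜 P h r) : ‖r‖ ≤ 8 * ‖h‖ := by
  simpa using h1.bound hP (DD.zero hP)

theorem DD.add (hP : PR M 𝒜 P) {h h' : A} {r r' : H →L[ℂ] H} (h1 : DD 𝒜 P h r)
    (h2 : DD 𝒜 P h' r') : DD 𝒜 P (h + h') (r + r') := by
  obtain ⟨V, hV, hV0, hVd, hVP⟩ := h1
  obtain ⟨W, hW, hW0, hWd, hWP⟩ := h2
  refine ⟨fun t => V t * W t, fun t => WU_mul (hV t) (hW t), by simp [hV0, hW0], ?_, ?_⟩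
  · have := hVd.mul hWd
    simp only [hV0, hW0, mul_one, one_mul] at this
    exact this
  · have := hVP.mul hWP
    simp only [hV0, hW0, hP.one, mul_one, one_mul] at this
    refine this.congr_of_eventuallyEq (Eventually.of_forall fun t => ?_)
    exact hP.mul _ (hV t) _ (hW t)

theorem DD.smul {h : A} {r : H →L[ℂ] H} (h1 : DD 𝒜 P h r) (c : ℝ) :
    DD 𝒜 P (c • h) (c • r) := by
  obtain ⟨V, hV, hV0, hVd, hVP⟩ := h1
  have hl : HasDerivAt (fun t : ℝ => c * t) c 0 := by
    simpa using (hasDerivAt_id (0 : ℝ)).const_mul c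
  refine ⟨fun t => V (c * t), fun t => hV _, by simp [hV0], ?_, ?_⟩
  · exact HasDerivAt.scomp (g₁ := V) (h := fun t : ℝ => c * t) 0 (by simpa using hVd) hl
  · exact HasDerivAt.scomp (g₁ := fun t => P (V t)) (h := fun t : ℝ => c * t) 0 (by simpa using hVP) hl

theorem DD.mem (hP : PR M 𝒜 P) {h : A} {r : H →L[ℂ] H} (h1 : DD 𝒜 P h r) : r ∈ M := by
  obtain ⟨V, hV, hV0, hVd, hVP⟩ := h1
  refine (vN_isClosed M).mem_of_tendsto hVP.tendsto_slope (Eventually.of_forall fun t => ?_)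
  simp only [slope, vsub_eq_sub]
  have := vN_smul_mem M (((t - 0)⁻¹ : ℝ) : ℂ) (sub_mem (hP.mem _ (hV t)) (hP.mem _ (hV 0)))
  rwa [Complex.coe_smul] at this

theorem uz_deriv {B : Type*} [NormedRing B] [NormedAlgebra ℂ B] (p : B) :
    HasDerivAt (fun t : ℝ => uz p (Complex.exp (t * Complex.I))) (Complex.I • p) 0 := by
  have h1 : HasDerivAt (fun t : ℝ => (t : ℂ) * Complex.I) Complex.I 0 := by
    simpa using (Complex.ofRealCLM.hasDerivAt (x := (0 : ℝ))).mul_const Complex.I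
  have h2 := (h1.cexp.sub_const 1).smul_const p
  have h3 := h2.const_add 1
  simpa [uz] using h3

theorem DD.proj (hP : PR M 𝒜 P) (h : IsApproxStarHom δ φ)
    (hc : ∀ a ∈ WU 𝒜, ‖P a - th φ a‖ ≤ κ) (hk : κ + 3 * δ ≤ 1 / 12)
    {p : A} (hp : IsStarProjection p) (hpA : p ∈ 𝒜) :
    DD 𝒜 P (Complex.I • p) (Complex.I • qp P p) := by
  have hn : ∀ t : ℝ, ‖Complex.exp (t * Complex.I)‖ = 1 := Complex.norm_exp_ofReal_mul_I
  refine ⟨fun t : ℝ => uz p (Complex.exp (t * Complex.I)), fun t => uz_mem hp hpA (hn t), ?_,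
    uz_deriv p, ?_⟩
  · simp [uz_one]
  · refine (uz_deriv (qp P p)).congr_of_eventuallyEq (Eventually.of_forall fun t => ?_)
    exact P_uz hP h hc hk hp hpA (hn t)

/-- the graph of the linear extension -/
def RR (𝒜 : StarSubalgebra ℂ A) (P : A → (H →L[ℂ] H)) (a : A) (b : H →L[ℂ] H) : Prop :=
  ∃ r s, DD 𝒜 P (Complex.I • (ℜ a : A)) r ∧ DD 𝒜 P (Complex.I • (ℑ a : A)) s ∧ b = -Complex.I • r + s

theorem RR.unique (hP : PR M 𝒜 P) {a : A} {b b' : H →L[ℂ] H} (h1 : RR 𝒜 P a b)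
    (h2 : RR 𝒜 P a b') : b = b' := by
  obtain ⟨r, s, hr, hs, rfl⟩ := h1
  obtain ⟨r', s', hr', hs', rfl⟩ := h2
  rw [hr.unique hP hr', hs.unique hP hs']

theorem RR.add (hP : PR M 𝒜 P) {a a' : A} {b b' : H →L[ℂ] H} (h1 : RR 𝒜 P a b)
    (h2 : RR 𝒜 P a' b') : RR 𝒜 P (a + a') (b + b') := by
  obtain ⟨r, s, hr, hs, rfl⟩ := h1
  obtain ⟨r', s', hr', hs', rfl⟩ := h2
  refine ⟨r + r', s + s', ?_, ?_, by module⟩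
  · have := hr.add hP hr'
    simpa [smul_add] using this
  · have := hs.add hP hs'
    simpa [smul_add] using this

theorem RR.rsmul {a : A} {b : H →L[ℂ] H} (h1 : RR 𝒜 P a b) (c : ℝ) : RR 𝒜 P ((c : ℂ) • a) ((c : ℂ) • b) := by
  obtain ⟨r, s, hr, hs, rfl⟩ := h1
  refine ⟨c • r, c • s, ?_, ?_, ?_⟩
  · have := hr.smul c
    rw [smul_comm] at this
    simpa using this
  · have := hs.smul c
    rw [smul_comm] at this
    simpa using this
  · rw [← Complex.coe_smul, ← Complex.coe_smul]; module

theorem RR.ismul {a : A} {b : H →L[ℂ] H} (h1 : RR 𝒜 P a b) :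
    RR 𝒜 P (Complex.I • a) (Complex.I • b) := by
  obtain ⟨r, s, hr, hs, rfl⟩ := h1
  refine ⟨-s, r, ?_, ?_, ?_⟩
  · have := hs.smul (-1)
    simpa [realPart_I_smul] using this
  · simpa [imaginaryPart_I_smul] using hr
  · rw [smul_add, smul_smul]; simp; rw [add_comm]

theorem RR.smul (hP : PR M 𝒜 P) {a : A} {b : H →L[ℂ] H} (h1 : RR 𝒜 P a b) (c : ℂ) :
    RR 𝒜 P (c • a) (c • b) := by
  have := (h1.rsmul c.re).add hP (h1.ismul.rsmul c.im)
  rw [smul_smul, smul_smul, ← add_smul, ← add_smul, Complex.re_add_im] at this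
  exact this

theorem RR.norm_le (hP : PR M 𝒜 P) {a : A} {b : H →L[ℂ] H} (h1 : RR 𝒜 P a b) : ‖b‖ ≤ 16 * ‖a‖ := by
  obtain ⟨r, s, hr, hs, rfl⟩ := h1
  have h1 := hr.norm_le hP
  have h2 := hs.norm_le hP
  rw [norm_smul, Complex.norm_I, one_mul] at h1 h2
  have h3 : ‖(ℜ a : A)‖ ≤ ‖a‖ := realPart.norm_le a
  have h4 : ‖(ℑ a : A)‖ ≤ ‖a‖ := imaginaryPart.norm_le a
  refine (norm_add_le _ _).trans ?_
  rw [norm_smul, norm_neg, Complex.norm_I, one_mul]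
  linarith

theorem RR.mem (hP : PR M 𝒜 P) {a : A} {b : H →L[ℂ] H} (h1 : RR 𝒜 P a b) : b ∈ M := by
  obtain ⟨r, s, hr, hs, rfl⟩ := h1
  exact add_mem (vN_smul_mem M _ (hr.mem hP)) (hs.mem hP)

theorem RR.proj (hP : PR M 𝒜 P) (h : IsApproxStarHom δ φ)
    (hc : ∀ a ∈ WU 𝒜, ‖P a - th φ a‖ ≤ κ) (hk : κ + 3 * δ ≤ 1 / 12)
    {p : A} (hp : IsStarProjection p) (hpA : p ∈ 𝒜) : RR 𝒜 P p (qp P p) := by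
  refine ⟨Complex.I • qp P p, 0, ?_, ?_, ?_⟩
  · rw [hp.isSelfAdjoint.coe_realPart]; exact DD.proj hP h hc hk hp hpA
  · rw [hp.isSelfAdjoint.imaginaryPart]; simpa using DD.zero hP
  · rw [smul_smul]; simp

theorem RR.sa_exists (hP : PR M 𝒜 P) (h : IsApproxStarHom δ φ)
    (hc : ∀ a ∈ WU 𝒜, ‖P a - th φ a‖ ≤ κ) (hk : κ + 3 * δ ≤ 1 / 12)
    (hlf : ∀ a ∈ 𝒜, ∃ S : StarSubalgebra ℂ A, S ≤ 𝒜 ∧ FiniteDimensional ℂ S ∧ a ∈ S)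
    {a : A} (ha : a ∈ 𝒜) (hs : IsStarNormal a) : ∃ b, RR 𝒜 P a b := by
  classical
  obtain ⟨S, hS, hfd, haS⟩ := hlf a ha
  obtain ⟨s, Q, -, hQS, hQ, -, -, rfl⟩ := spectral haS
  clear haS ha hs
  induction s using Finset.induction_on with
  | empty =>
    refine ⟨0, 0, 0, ?_, ?_, ?_⟩
    · simpa using DD.zero hP
    · simpa using DD.zero hP
    · simp
  | insert z s hz ih =>
    obtain ⟨b, hb⟩ := ih
    rw [Finset.sum_insert hz]
    exact ⟨_, ((RR.proj hP h hc hk (hQ z) (hS (hQS z))).smul hP z).add hP hb⟩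

theorem RR.exists (hP : PR M 𝒜 P) (h : IsApproxStarHom δ φ)
    (hc : ∀ a ∈ WU 𝒜, ‖P a - th φ a‖ ≤ κ) (hk : κ + 3 * δ ≤ 1 / 12)
    (hlf : ∀ a ∈ 𝒜, ∃ S : StarSubalgebra ℂ A, S ≤ 𝒜 ∧ FiniteDimensional ℂ S ∧ a ∈ S)
    {a : A} (ha : a ∈ 𝒜) : ∃ b, RR 𝒜 P a b := by
  have hr : (ℜ a : A) ∈ 𝒜 := by
    rw [realPart_apply_coe, ← Complex.coe_smul]
    exact SMulMemClass.smul_mem _ (add_mem ha (star_mem ha))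
  have hi : (ℑ a : A) ∈ 𝒜 := by
    rw [imaginaryPart_apply_coe, ← Complex.coe_smul]
    exact SMulMemClass.smul_mem _ (SMulMemClass.smul_mem _ (sub_mem ha (star_mem ha)))
  obtain ⟨b, hb⟩ := RR.sa_exists hP h hc hk hlf hr (ℜ a).2.isStarNormal
  obtain ⟨b', hb'⟩ := RR.sa_exists hP h hc hk hlf hi (ℑ a).2.isStarNormal
  have := hb.add hP hb'.ismul
  rw [realPart_add_I_smul_imaginaryPart] at this
  exact ⟨_, this⟩

theorem exists_psi (hP : PR M 𝒜 P) (h : IsApproxStarHom δ φ)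
    (hc : ∀ a ∈ WU 𝒜, ‖P a - th φ a‖ ≤ κ) (hk : κ + 3 * δ ≤ 1 / 12)
    (hlf : ∀ a ∈ 𝒜, ∃ S : StarSubalgebra ℂ A, S ≤ 𝒜 ∧ FiniteDimensional ℂ S ∧ a ∈ S) :
    ∃ ψ : 𝒜 →ₗ[ℂ] (H →L[ℂ] H), (∀ a, ψ a ∈ M) ∧ (∀ a, ‖ψ a‖ ≤ 16 * ‖(a : A)‖) ∧
      ∀ p : 𝒜, IsStarProjection (p : A) → ψ p = qp P (p : A) := by
  have hex : ∀ a : 𝒜, ∃ b, RR 𝒜 P (a : A) b := fun a => RR.exists hP h hc hk hlf a.2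
  choose f hf using hex
  refine ⟨⟨⟨f, fun a b => ?_⟩, fun c a => ?_⟩, fun a => (hf a).mem hP, fun a => (hf a).norm_le hP,
    fun p hp => ?_⟩
  · exact (hf (a + b)).unique hP ((hf a).add hP (hf b))
  · exact (hf (c • a)).unique hP ((hf a).smul hP c)
  · exact (hf p).unique hP (RR.proj hP h hc hk hp p.2)

end deriv
end UlamAF


open scoped BoundedContinuousFunction InnerProductSpace ComplexStarModule
open Filter Topology
set_option linter.unusedSectionVars false
namespace UlamAF

section ext
variable {H : Type*} [NormedAddCommGroup H] [InnerProductSpace ℂ H] [CompleteSpace H]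
variable {A : Type*} [CStarAlgebra A]
variable {φ : A → (H →L[ℂ] H)} {δ κ : ℝ} {M : VonNeumannAlgebra H} {𝒜 : StarSubalgebra ℂ A}
  {P : A → (H →L[ℂ] H)}

theorem idem_orth {B : Type*} [Ring B] [Algebra ℂ B] {q r : B} (hq : q * q = q) (hr : r * r = r)
    (h : (q + r) * (q + r) = q + r) : q * r = 0 := by
  have h0 : q * r + r * q = 0 := by
    have : (q + r) * (q + r) = q * q + r * r + (q * r + r * q) := by noncomm_ring
    rw [h, hq, hr] at this
    exact left_eq_add.1 this
  have h1 : q * r + q * r * q = 0 := by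
    have := congrArg (fun x => q * x) h0
    simp only [mul_add, mul_zero, ← mul_assoc, hq] at this
    exact this
  have h2 : q * r * q + r * q = 0 := by
    have := congrArg (fun x => x * q) h0
    simp only [add_mul, zero_mul, mul_assoc, hq] at this
    rw [mul_assoc]; exact this
  have h3 : q * r = r * q := by
    have : q * r + q * r * q = q * r * q + r * q := h1.trans h2.symm
    rw [add_comm] at this
    exact add_left_cancel this
  rw [← h3] at h0
  have h4 : (2 : ℂ) • (q * r) = 0 := by rw [two_smul]; exact h0
  exact (smul_eq_zero.1 h4).resolve_left two_ne_zero

theorem qp_orth (hP : PR M 𝒜 P) {ψ : 𝒜 →ₗ[ℂ] (H →L[ℂ] H)}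
    (hψ : ∀ p : 𝒜, IsStarProjection (p : A) → ψ p = qp P (p : A))
    {p r : A} (hp : IsStarProjection p) (hr : IsStarProjection r) (hpA : p ∈ 𝒜) (hrA : r ∈ 𝒜)
    (h1 : p * r = 0) (h2 : r * p = 0) : qp P p * qp P r = 0 := by
  have hs : IsStarProjection (p + r) := by
    constructor
    · show (p + r) * (p + r) = p + r
      have a1 : p * p = p := hp.isIdempotentElem
      have a2 : r * r = r := hr.isIdempotentElem
      simp [mul_add, add_mul, h1, h2, a1, a2]
    · exact hp.isSelfAdjoint.add hr.isSelfAdjoint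
  have e : qp P (p + r) = qp P p + qp P r := by
    have := ψ.map_add ⟨p, hpA⟩ ⟨r, hrA⟩
    rw [hψ ⟨p, hpA⟩ hp, hψ ⟨r, hrA⟩ hr] at this
    rw [← this]
    exact (hψ ⟨p + r, add_mem hpA hrA⟩ hs).symm
  have i := (qp_proj hP hs (add_mem hpA hrA)).isIdempotentElem
  rw [e] at i
  exact idem_orth (qp_proj hP hp hpA).isIdempotentElem (qp_proj hP hr hrA).isIdempotentElem i

theorem psi_unit (hP : PR M 𝒜 P) (h : IsApproxStarHom δ φ)
    (hc : ∀ a ∈ WU 𝒜, ‖P a - th φ a‖ ≤ κ) (hk : κ + 3 * δ ≤ 1 / 12)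
    (hlf : ∀ a ∈ 𝒜, ∃ S : StarSubalgebra ℂ A, S ≤ 𝒜 ∧ FiniteDimensional ℂ S ∧ a ∈ S)
    {ψ : 𝒜 →ₗ[ℂ] (H →L[ℂ] H)}
    (hψ : ∀ p : 𝒜, IsStarProjection (p : A) → ψ p = qp P (p : A))
    (u : 𝒜) (hu : (u : A) ∈ unitary A) : P u = 1 - ψ 1 + ψ u := by
  classical
  obtain ⟨S, hS, hfd, huS⟩ := hlf u u.2
  have hun : IsStarNormal (u : A) := ⟨by
    rw [commute_iff_eq, Unitary.star_mul_self_of_mem hu, Unitary.mul_star_self_of_mem hu]⟩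
  obtain ⟨s, Q, hsp, hQS, hQ, hQo, hQ1, hQu⟩ := spectral huS
  have hQA : ∀ z, Q z ∈ 𝒜 := fun z => hS (hQS z)
  have hn : ∀ z ∈ s, ‖z‖ = 1 := fun z hz => spectrum.norm_eq_one_of_unitary hu (hsp z hz)
  have key : ∀ t : Finset ℂ, t ⊆ s → (1 + ∑ z ∈ t, (z - 1) • Q z) ∈ WU 𝒜 ∧
      P (1 + ∑ z ∈ t, (z - 1) • Q z) = 1 + ∑ z ∈ t, (z - 1) • qp P (Q z) := by
    intro t
    induction t using Finset.induction_on with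
    | empty => intro _; simp [WU_one, hP.one]
    | insert w t hw ih =>
      intro hts
      obtain ⟨i1, i2⟩ := ih ((Finset.subset_insert _ _).trans hts)
      have hwn := hn w (hts (Finset.mem_insert_self _ _))
      have e1 : (1 + ∑ z ∈ insert w t, (z - 1) • Q z) = (1 + ∑ z ∈ t, (z - 1) • Q z) * uz (Q w) w := by
        have : (∑ z ∈ t, (z - 1) • Q z) * Q w = 0 := by
          rw [Finset.sum_mul]
          refine Finset.sum_eq_zero fun z hz => ?_
          rw [smul_mul_assoc, hQo z w (fun hh => hw (hh ▸ hz)), smul_zero]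
        rw [Finset.sum_insert hw, uz, mul_add, mul_one, mul_smul_comm, add_mul, this]
        simp only [one_mul, add_zero]
        abel
      have e2 : (1 + ∑ z ∈ insert w t, (z - 1) • qp P (Q z))
          = (1 + ∑ z ∈ t, (z - 1) • qp P (Q z)) * uz (qp P (Q w)) w := by
        have : (∑ z ∈ t, (z - 1) • qp P (Q z)) * qp P (Q w) = 0 := by
          rw [Finset.sum_mul]
          refine Finset.sum_eq_zero fun z hz => ?_
          have hne : z ≠ w := fun hh => hw (hh ▸ hz)
          rw [smul_mul_assoc, qp_orth hP hψ (hQ z) (hQ w) (hQA z) (hQA w) (hQo z w hne)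
            (hQo w z hne.symm), smul_zero]
        rw [Finset.sum_insert hw, uz, mul_add, mul_one, mul_smul_comm, add_mul, this]
        simp only [one_mul, add_zero]
        abel
      have hm := uz_mem (hQ w) (hQA w) hwn
      rw [e1, e2]
      refine ⟨WU_mul i1 hm, ?_⟩
      rw [hP.mul _ i1 _ hm, i2, P_uz hP h hc hk (hQ w) (hQA w) hwn]
  have k := (key s (Finset.Subset.refl _)).2
  simp only [sub_smul, one_smul, Finset.sum_sub_distrib] at k
  rw [hQ1, ← hQu] at k
  have c1 : (1 : A) + ((u : A) - 1) = u := by abel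
  rw [c1] at k
  have f1 : (1 : 𝒜) = ∑ z ∈ s, (⟨Q z, hQA z⟩ : 𝒜) := by
    apply Subtype.ext; simp [hQ1]
  have f2 : u = ∑ z ∈ s, z • (⟨Q z, hQA z⟩ : 𝒜) := by
    apply Subtype.ext; simp [← hQu]
  have g1 : ψ 1 = ∑ z ∈ s, qp P (Q z) := by
    rw [f1, map_sum]
    exact Finset.sum_congr rfl fun z _ => hψ ⟨Q z, hQA z⟩ (hQ z)
  have g2 : ψ u = ∑ z ∈ s, z • qp P (Q z) := by
    rw [f2, map_sum]
    refine Finset.sum_congr rfl fun z _ => ?_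
    rw [map_smul, hψ ⟨Q z, hQA z⟩ (hQ z)]
  rw [k, g1, g2]; abel

/-- induction principle: unitaries span -/
theorem span_unitary
    (hlf : ∀ a ∈ 𝒜, ∃ S : StarSubalgebra ℂ A, S ≤ 𝒜 ∧ FiniteDimensional ℂ S ∧ a ∈ S)
    (a : 𝒜) (ha : ‖(a : A)‖ ≤ 1) : ∃ u v : 𝒜, (u : A) ∈ unitary A ∧ (v : A) ∈ unitary A ∧
      a = (1 / 2 : ℂ) • (u + star u) + Complex.I • ((1 / 2 : ℂ) • (v + star v)) := by
  obtain ⟨S, hS, hfd, haS⟩ := hlf a a.2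
  have hr : (ℜ (a : A) : A) ∈ S := by
    rw [realPart_apply_coe, ← Complex.coe_smul]
    exact SMulMemClass.smul_mem _ (add_mem haS (star_mem haS))
  have hi : (ℑ (a : A) : A) ∈ S := by
    rw [imaginaryPart_apply_coe, ← Complex.coe_smul]
    exact SMulMemClass.smul_mem _ (SMulMemClass.smul_mem _ (sub_mem haS (star_mem haS)))
  have h3 : ‖(ℜ (a : A) : A)‖ ≤ 1 := (realPart.norm_le (a : A)).trans ha
  have h4 : ‖(ℑ (a : A) : A)‖ ≤ 1 := (imaginaryPart.norm_le (a : A)).trans ha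
  obtain ⟨u, hu, eu⟩ := exists_unitary_avg hr (ℜ (a : A)).2 h3
  obtain ⟨v, hv, ev⟩ := exists_unitary_avg hi (ℑ (a : A)).2 h4
  refine ⟨⟨u, hS hu⟩, ⟨v, hS hv⟩, u.2, v.2, ?_⟩
  apply Subtype.ext
  have := realPart_add_I_smul_imaginaryPart (a : A)
  rw [eu, ev] at this
  exact this.symm

theorem scale_ball (p : 𝒜 → Prop) (hp : ∀ a : 𝒜, ‖(a : A)‖ ≤ 1 → p a)
    (hs : ∀ (c : ℂ) (a : 𝒜), p a → p (c • a)) (a : 𝒜) : p a := by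
  have h1 : p (((‖(a : A)‖⁻¹ : ℝ) : ℂ) • a) := by
    apply hp
    show ‖((‖(a : A)‖⁻¹ : ℝ) : ℂ) • (a : A)‖ ≤ 1
    rw [norm_smul, Complex.norm_real, norm_inv, norm_norm]
    exact inv_mul_le_one
  have h2 := hs ((‖(a : A)‖ : ℝ) : ℂ) _ h1
  have e : ((‖(a : A)‖ : ℝ) : ℂ) • (((‖(a : A)‖⁻¹ : ℝ) : ℂ) • a) = a := by
    rcases eq_or_ne (a : A) 0 with h0 | h0
    · have : a = 0 := Subtype.ext h0
      subst this; simp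
    · rw [smul_smul, ← Complex.ofReal_mul, mul_inv_cancel₀ (norm_ne_zero_iff.2 h0)]; simp
  rwa [e] at h2

theorem psi_ind (hlf : ∀ a ∈ 𝒜, ∃ S : StarSubalgebra ℂ A, S ≤ 𝒜 ∧ FiniteDimensional ℂ S ∧ a ∈ S)
    (p : 𝒜 → Prop) (hu : ∀ u : 𝒜, (u : A) ∈ unitary A → p u)
    (hadd : ∀ a b, p a → p b → p (a + b)) (hs : ∀ (c : ℂ) (a : 𝒜), p a → p (c • a)) (a : 𝒜) : p a := by
  refine scale_ball p (fun a ha => ?_) hs a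
  obtain ⟨u, v, hu1, hv1, e⟩ := span_unitary hlf a ha
  have st : ∀ u : 𝒜, (u : A) ∈ unitary A → ((star u : 𝒜) : A) ∈ unitary A := fun u h =>
    Unitary.star_mem h
  rw [e]
  exact hadd _ _ (hs _ _ (hadd _ _ (hu _ hu1) (hu _ (st _ hu1))))
    (hs _ _ (hs _ _ (hadd _ _ (hu _ hv1) (hu _ (st _ hv1)))))

theorem neg_unitary {u : A} (hu : u ∈ unitary A) : -u ∈ unitary A := by
  rw [Unitary.mem_iff] at hu ⊢
  simpa using hu

theorem alg_mul {B : Type*} [Ring B] [Algebra ℂ B] {e a b c : B}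
    (h1 : 1 - e + c = (1 - e + a) * (1 - e + b)) (h2 : 1 - e - c = (1 - e + a) * (1 - e - b))
    (h3 : 1 - e - c = (1 - e - a) * (1 - e + b)) (h4 : 1 - e + c = (1 - e - a) * (1 - e - b)) :
    c = a * b := by
  have : (4 : ℂ) • c = (4 : ℂ) • (a * b) := by
    have e1 : (1 - e + c) - (1 - e - c) - (1 - e - c) + (1 - e + c) = (4 : ℂ) • c := by module
    have e2 : (1 - e + a) * (1 - e + b) - (1 - e + a) * (1 - e - b) - (1 - e - a) * (1 - e + b)
      + (1 - e - a) * (1 - e - b) = (4 : ℂ) • (a * b) := by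
      simp only [add_mul, sub_mul, mul_add, mul_sub, one_mul, mul_one]; module
    rw [← e1, ← e2, ← h1, ← h2, ← h3, ← h4]
  exact smul_right_injective B (by norm_num : (4 : ℂ) ≠ 0) this

theorem psi_mul (hP : PR M 𝒜 P) 
    (hlf : ∀ a ∈ 𝒜, ∃ S : StarSubalgebra ℂ A, S ≤ 𝒜 ∧ FiniteDimensional ℂ S ∧ a ∈ S)
    {ψ : 𝒜 →ₗ[ℂ] (H →L[ℂ] H)}
    (hU : ∀ u : 𝒜, (u : A) ∈ unitary A → P u = 1 - ψ 1 + ψ u) (a b : 𝒜) :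
    ψ (a * b) = ψ a * ψ b := by
  have huv : ∀ u v : 𝒜, (u : A) ∈ unitary A → (v : A) ∈ unitary A → ψ (u * v) = ψ u * ψ v := by
    intro u v hu hv
    have key : ∀ u v : 𝒜, (u : A) ∈ unitary A → (v : A) ∈ unitary A →
        1 - ψ 1 + ψ (u * v) = (1 - ψ 1 + ψ u) * (1 - ψ 1 + ψ v) := by
      intro u v hu hv
      rw [← hU u hu, ← hU v hv, ← hU (u * v) (mul_mem hu hv)]
      exact hP.mul _ ⟨hu, u.2⟩ _ ⟨hv, v.2⟩
    have hu' : ((-u : 𝒜) : A) ∈ unitary A := neg_unitary hu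
    have hv' : ((-v : 𝒜) : A) ∈ unitary A := neg_unitary hv
    have k1 := key u v hu hv
    have k2 := key u (-v) hu hv'
    have k3 := key (-u) v hu' hv
    have k4 := key (-u) (-v) hu' hv'
    simp only [mul_neg, neg_mul, neg_neg, map_neg] at k2 k3 k4
    rw [← sub_eq_add_neg, ← sub_eq_add_neg] at k2 k3
    rw [← sub_eq_add_neg, ← sub_eq_add_neg] at k4
    exact alg_mul k1 k2 k3 k4
  have h1 : ∀ u : 𝒜, (u : A) ∈ unitary A → ∀ b, ψ (u * b) = ψ u * ψ b := fun u hu =>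
    psi_ind hlf _ (fun v hv => huv u v hu hv)
      (fun a b ha hb => by rw [mul_add, map_add, map_add, mul_add, ha, hb])
      (fun c a ha => by rw [mul_smul_comm, map_smul, map_smul, mul_smul_comm, ha])
  exact psi_ind hlf (fun a => ψ (a * b) = ψ a * ψ b) (fun u hu => h1 u hu b)
      (fun a c ha hc => by rw [add_mul, map_add, map_add, add_mul, ha, hc])
      (fun c a ha => by rw [smul_mul_assoc, map_smul, map_smul, smul_mul_assoc, ha]) a

theorem psi_star (hP : PR M 𝒜 P) 
    (hlf : ∀ a ∈ 𝒜, ∃ S : StarSubalgebra ℂ A, S ≤ 𝒜 ∧ FiniteDimensional ℂ S ∧ a ∈ S)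
    {ψ : 𝒜 →ₗ[ℂ] (H →L[ℂ] H)}
    (hU : ∀ u : 𝒜, (u : A) ∈ unitary A → P u = 1 - ψ 1 + ψ u) (he : star (ψ 1) = ψ 1) (a : 𝒜) :
    ψ (star a) = star (ψ a) := by
  refine psi_ind hlf (fun a => ψ (star a) = star (ψ a)) (fun u hu => ?_)
    (fun a b ha hb => by simp only [star_add, map_add, ha, hb])
    (fun c a ha => by simp only [star_smul, map_smul, ha]) a
  have h1 := hP.star _ (⟨hu, u.2⟩ : (u : A) ∈ WU 𝒜)
  have h2 : P (star (u : A)) = 1 - ψ 1 + ψ (star u) := hU (star u) (Unitary.star_mem hu)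
  rw [h2, hU u hu, star_add, star_sub, star_one, he] at h1
  exact add_left_cancel h1

theorem near_one (h : IsApproxStarHom δ φ)
    (hc : ∀ a ∈ WU 𝒜, ‖P a - th φ a‖ ≤ κ)
    {ψ : 𝒜 →ₗ[ℂ] (H →L[ℂ] H)}
    (hU : ∀ u : 𝒜, (u : A) ∈ unitary A → P u = 1 - ψ 1 + ψ u) : 2 * ‖φ 1 - ψ 1‖ ≤ κ + δ := by
  have h1 := hc (-1) ⟨neg_unitary (one_mem _), neg_mem (one_mem _)⟩
  have h2 : P (-1 : A) = 1 - ψ 1 + ψ (-1) := hU (-1) (neg_unitary (one_mem _))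
  have h3 := h.2.1 1 (-1) norm_one_le_A (by simp)
  rw [h2, map_neg, th] at h1
  rw [neg_smul, one_smul, neg_smul, one_smul] at h3
  have e : (2 : ℂ) • (φ 1 - ψ 1) = (1 - ψ 1 + -ψ 1 - (φ (-1) + (1 - φ 1))) + (φ (-1) - -φ 1) := by module
  have := norm_add_le (1 - ψ 1 + -ψ 1 - (φ (-1) + (1 - φ 1))) (φ (-1) - -φ 1)
  rw [← e, norm_smul] at this
  simp only [Complex.norm_ofNat] at this
  linarith

theorem near_unitary (h : IsApproxStarHom δ φ)
    (hc : ∀ a ∈ WU 𝒜, ‖P a - th φ a‖ ≤ κ)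
    {ψ : 𝒜 →ₗ[ℂ] (H →L[ℂ] H)}
    (hU : ∀ u : 𝒜, (u : A) ∈ unitary A → P u = 1 - ψ 1 + ψ u) (u : 𝒜) (hu : (u : A) ∈ unitary A) :
    ‖φ u - ψ u‖ ≤ 2 * κ + δ := by
  have h0 := near_one h hc hU
  have h1 := hc u ⟨hu, u.2⟩
  rw [hU u hu, th] at h1
  have e : φ u - ψ u = (φ 1 - ψ 1) - (1 - ψ 1 + ψ u - (φ u + (1 - φ 1))) := by abel
  rw [e]
  have := norm_sub_le (φ 1 - ψ 1) (1 - ψ 1 + ψ u - (φ u + (1 - φ 1)))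
  have := norm_nonneg (φ 1 - ψ 1)
  linarith [delta_nonneg h]

theorem near_half (h : IsApproxStarHom δ φ)
    (hc : ∀ a ∈ WU 𝒜, ‖P a - th φ a‖ ≤ κ)
    {ψ : 𝒜 →ₗ[ℂ] (H →L[ℂ] H)}
    (hU : ∀ u : 𝒜, (u : A) ∈ unitary A → P u = 1 - ψ 1 + ψ u) (u : 𝒜) (hu : (u : A) ∈ unitary A) :
    ‖φ (((1 / 2 : ℂ) • (u + star u) : 𝒜) : A) - ψ ((1 / 2 : ℂ) • (u + star u))‖ ≤ 4 * δ + 2 * κ ∧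
    ‖(((1 / 2 : ℂ) • (u + star u) : 𝒜) : A)‖ ≤ 1 := by
  have hu' : ((star u : 𝒜) : A) ∈ unitary A := Unitary.star_mem hu
  have n1 : ‖(u : A)‖ ≤ 1 := norm_unitary_le ⟨_, hu⟩
  have n2 : ‖((star u : 𝒜) : A)‖ ≤ 1 := norm_unitary_le ⟨_, hu'⟩
  have a1 := near_unitary h hc hU u hu
  have a2 := near_unitary h hc hU (star u) hu'
  have e0 : (((1 / 2 : ℂ) • (u + star u) : 𝒜) : A) =
      (1 / 2 : ℂ) • (u : A) + (1 / 2 : ℂ) • ((star u : 𝒜) : A) := smul_add _ _ _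
  have m : ∀ x : A, ‖x‖ ≤ 1 → ‖(1 / 2 : ℂ) • x‖ ≤ 1 / 2 := fun x hx => by
    rw [norm_smul]; norm_num; linarith
  have m' : ∀ x : H →L[ℂ] H, ‖(1 / 2 : ℂ) • x‖ = 1 / 2 * ‖x‖ := fun x => by
    rw [norm_smul]; norm_num
  have m1 := m _ n1
  have m2 := m _ n2
  have b1 := h.2.1 u (1 / 2) n1 (by norm_num)
  have b2 := h.2.1 (star u : 𝒜) (1 / 2) n2 (by norm_num)
  have b3 := h.1 _ _ (m1.trans (by norm_num)) (m2.trans (by norm_num))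
  constructor
  · rw [e0, map_smul, map_add]
    have e : φ ((1 / 2 : ℂ) • (u : A) + (1 / 2 : ℂ) • ((star u : 𝒜) : A)) - (1 / 2 : ℂ) • (ψ u + ψ (star u))
      = (φ ((1 / 2 : ℂ) • (u : A) + (1 / 2 : ℂ) • ((star u : 𝒜) : A)) - φ ((1 / 2 : ℂ) • (u : A)) - φ ((1 / 2 : ℂ) • ((star u : 𝒜) : A)))
        + (φ ((1 / 2 : ℂ) • (u : A)) - (1 / 2 : ℂ) • φ u) + (φ ((1 / 2 : ℂ) • ((star u : 𝒜) : A)) - (1 / 2 : ℂ) • φ ((star u : 𝒜) : A))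
        + (1 / 2 : ℂ) • (φ u - ψ u) + (1 / 2 : ℂ) • (φ ((star u : 𝒜) : A) - ψ (star u)) := by module
    rw [e]
    refine (norm_add_le _ _).trans ?_
    rw [m']
    refine (add_le_add_left ((norm_add_le _ _).trans (add_le_add_left norm_add₃_le _)) _).trans ?_
    rw [m']
    linarith
  · rw [e0]
    refine (norm_add_le _ _).trans ?_
    linarith

theorem near_ball (h : IsApproxStarHom δ φ)
    (hc : ∀ a ∈ WU 𝒜, ‖P a - th φ a‖ ≤ κ)
    (hlf : ∀ a ∈ 𝒜, ∃ S : StarSubalgebra ℂ A, S ≤ 𝒜 ∧ FiniteDimensional ℂ S ∧ a ∈ S)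
    {ψ : 𝒜 →ₗ[ℂ] (H →L[ℂ] H)}
    (hU : ∀ u : 𝒜, (u : A) ∈ unitary A → P u = 1 - ψ 1 + ψ u) (a : 𝒜) (ha : ‖(a : A)‖ ≤ 1) :
    ‖φ a - ψ a‖ ≤ 10 * δ + 4 * κ := by
  obtain ⟨u, v, hu, hv, e⟩ := span_unitary hlf a ha
  obtain ⟨a1, a2⟩ := near_half h hc hU u hu
  obtain ⟨b1, b2⟩ := near_half h hc hU v hv
  rw [e]
  generalize ((1 / 2 : ℂ) • (u + star u) : 𝒜) = x at *
  generalize ((1 / 2 : ℂ) • (v + star v) : 𝒜) = y at *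
  have c1 := h.2.1 (y : A) Complex.I b2 (by simp)
  have c2 := h.1 (x : A) (Complex.I • (y : A)) a2 (by rw [norm_smul, Complex.norm_I, one_mul]; exact b2)
  have e0 : ((x + Complex.I • y : 𝒜) : A) = (x : A) + Complex.I • (y : A) := rfl
  rw [e0, map_add, map_smul]
  have e : φ ((x : A) + Complex.I • (y : A)) - (ψ x + Complex.I • ψ y) =
    (φ ((x : A) + Complex.I • (y : A)) - φ x - φ (Complex.I • (y : A))) +
    (φ (Complex.I • (y : A)) - Complex.I • φ y) + (φ x - ψ x) + Complex.I • (φ y - ψ y) := by module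
  rw [e]
  refine (norm_add_le _ _).trans ?_
  rw [norm_smul, Complex.norm_I, one_mul]
  refine (add_le_add_left norm_add₃_le _).trans ?_
  linarith

theorem extend_main (hP : PR M 𝒜 P) (h : IsApproxStarHom δ φ) (hδ0 : 0 < δ) (hδ : δ ≤ 1 / 2)
    (hc : ∀ a ∈ WU 𝒜, ‖P a - th φ a‖ ≤ κ) (hk : κ + 3 * δ ≤ 1 / 12)
    (hlf : ∀ a ∈ 𝒜, ∃ S : StarSubalgebra ℂ A, S ≤ 𝒜 ∧ FiniteDimensional ℂ S ∧ a ∈ S)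
    (hdense : Dense (𝒜 : Set A)) :
    ∃ ψ : A →⋆ₙₐ[ℂ] (H →L[ℂ] H), (∀ a : A, ψ a ∈ M) ∧
            ∀ x : A, ‖x‖ ≤ 1 → ‖φ x - ψ x‖ ≤ 50 * δ + 4 * κ := by
  obtain ⟨ψ, hψM, hψn, hψp⟩ := exists_psi hP h hc hk hlf
  have hU := psi_unit hP h hc hk hlf hψp
  have one_proj : IsStarProjection (((1 : 𝒜) : A)) := by
    constructor
    · show (1 : A) * 1 = 1
      simp
    · show star (1 : A) = 1
      simp
  have he : star (ψ 1) = ψ 1 := by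
    rw [hψp 1 one_proj]
    exact (qp_proj hP one_proj (1 : 𝒜).2).isSelfAdjoint
  have hmul := psi_mul hP hlf hU
  have hstar := psi_star hP hlf hU he
  have hnear := near_ball h hc hlf hU
  let e : 𝒜 →ₗ[ℂ] A := 𝒜.subtype.toAlgHom.toLinearMap
  have hee : ∀ a : 𝒜, e a = (a : A) := fun a => rfl
  have hde : DenseRange e := by
    have : Set.range e = (𝒜 : Set A) := by
      ext x; exact ⟨fun ⟨a, ha⟩ => ha ▸ a.2, fun hx => ⟨⟨x, hx⟩, rfl⟩⟩
    rw [DenseRange, this]; exact hdense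
  have hb : ∀ a, ‖ψ a‖ ≤ 16 * ‖e a‖ := hψn
  let Ψ : A →L[ℂ] (H →L[ℂ] H) := ψ.extendOfNorm e
  have hΨ : ∀ a : 𝒜, Ψ (a : A) = ψ a := fun a => LinearMap.extendOfNorm_eq hde ⟨16, hb⟩ a
  have hΨn : ∀ x : A, ‖Ψ x‖ ≤ 16 * ‖x‖ := LinearMap.norm_extendOfNorm_apply_le hde 16 hb
  have ind : ∀ p : A → Prop, IsClosed {x | p x} → (∀ a : 𝒜, p a) → ∀ x, p x := by
    intro p hp ha x
    exact hp.closure_subset_iff.2 (fun y (hy : y ∈ (𝒜 : Set A)) => ha ⟨y, hy⟩) (hdense x)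
  have Mul : ∀ x y, Ψ (x * y) = Ψ x * Ψ y := by
    have h1 : ∀ (a : 𝒜) (y : A), Ψ ((a : A) * y) = Ψ a * Ψ y := by
      intro a
      refine ind _ (isClosed_eq (by fun_prop) (by fun_prop)) fun b => ?_
      have : ((a * b : 𝒜) : A) = (a : A) * b := rfl
      rw [← this, hΨ, hΨ, hΨ, hmul]
    intro x y
    exact ind (fun x => Ψ (x * y) = Ψ x * Ψ y) (isClosed_eq (by fun_prop) (by fun_prop))
      (fun a => h1 a y) x
  have Star : ∀ x, Ψ (star x) = star (Ψ x) := by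
    refine ind _ (isClosed_eq (by fun_prop) (by fun_prop)) fun a => ?_
    have : ((star a : 𝒜) : A) = star (a : A) := rfl
    rw [← this, hΨ, hΨ, hstar]
  have Mem : ∀ x, Ψ x ∈ M := by
    refine ind _ ((vN_isClosed M).preimage Ψ.continuous) fun a => ?_
    rw [hΨ]; exact hψM a
  refine ⟨{ toFun := Ψ, map_smul' := fun c x => map_smul Ψ c x, map_zero' := map_zero Ψ,
            map_add' := map_add Ψ, map_mul' := Mul, map_star' := Star }, Mem, fun x hx => ?_⟩
  show ‖φ x - Ψ x‖ ≤ _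
  have hne : (Metric.ball (0 : A) 1 ∩ Metric.ball x δ).Nonempty := by
    refine ⟨((1 - δ / 2 : ℝ) : ℂ) • x, ?_, ?_⟩
    · rw [mem_ball_zero_iff, norm_smul, Complex.norm_real, Real.norm_of_nonneg (by linarith)]
      have := mul_le_mul_of_nonneg_left hx (by linarith : 0 ≤ 1 - δ / 2)
      linarith
    · rw [mem_ball_iff_norm]
      have e : ((1 - δ / 2 : ℝ) : ℂ) • x - x = ((-(δ / 2) : ℝ) : ℂ) • x := by
        push_cast; module
      rw [e, norm_smul, Complex.norm_real, norm_neg, Real.norm_of_nonneg (by linarith)]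
      have := mul_le_mul_of_nonneg_left hx (by linarith : 0 ≤ δ / 2)
      linarith
  obtain ⟨y, hyA, hy1, hy2⟩ := hdense.exists_mem_open
    (Metric.isOpen_ball.inter Metric.isOpen_ball) hne
  rw [mem_ball_zero_iff] at hy1
  rw [mem_ball_iff_norm, norm_sub_rev] at hy2
  have c1 := hnear ⟨y, hyA⟩ hy1.le
  rw [← hΨ] at c1
  have c2 := phi_cont h hy1.le (hy2.le.trans (by linarith) : ‖x - y‖ ≤ 1)
  have c3 := hΨn (x - y)
  rw [map_sub] at c3
  have c4 : ‖x - y‖ * (1 + δ) ≤ δ * 2 :=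
    mul_le_mul hy2.le (by linarith) (by linarith) hδ0.le
  have e : φ x - Ψ x = (φ x - φ y) + (φ y - Ψ y) - (Ψ x - Ψ y) := by abel
  rw [e]
  refine (norm_sub_le _ _).trans ?_
  have := norm_add_le (φ x - φ y) (φ y - Ψ y)
  change ‖φ y - Ψ y‖ ≤ _ at c1
  linarith

end ext
end UlamAF


open scoped BoundedContinuousFunction InnerProductSpace ComplexStarModule
open Filter Topology
set_option linter.unusedSectionVars false
namespace UlamAF

section final
variable {H : Type*} [NormedAddCommGroup H] [InnerProductSpace ℂ H] [CompleteSpace H]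
variable {A : Type*} [CStarAlgebra A]
variable {φ : A → (H →L[ℂ] H)} {δ κ : ℝ} {M : VonNeumannAlgebra H}

/-- the directed union of the finite-dimensional subalgebras -/
def AU (𝒮 : Set (StarSubalgebra ℂ A)) (hne : 𝒮.Nonempty) (hd : DirectedOn (· ≤ ·) 𝒮) :
    StarSubalgebra ℂ A where
  carrier := {a | ∃ S ∈ 𝒮, a ∈ S}
  mul_mem' := by
    rintro a b ⟨S, hS, ha⟩ ⟨T, hT, hb⟩
    obtain ⟨R, hR, h1, h2⟩ := hd S hS T hT
    exact ⟨R, hR, mul_mem (h1 ha) (h2 hb)⟩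
  add_mem' := by
    rintro a b ⟨S, hS, ha⟩ ⟨T, hT, hb⟩
    obtain ⟨R, hR, h1, h2⟩ := hd S hS T hT
    exact ⟨R, hR, add_mem (h1 ha) (h2 hb)⟩
  algebraMap_mem' := fun c => by
    obtain ⟨S, hS⟩ := hne
    exact ⟨S, hS, algebraMap_mem S c⟩
  star_mem' := by
    rintro a ⟨S, hS, ha⟩
    exact ⟨S, hS, star_mem ha⟩

theorem main_bound (hM : ∀ a, φ a ∈ M) (h : IsApproxStarHom δ φ) (hδ0 : 0 < δ) (hδ : δ ≤ 1 / 10 ^ 8)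
    (𝒮 : Set (StarSubalgebra ℂ A)) (hne : 𝒮.Nonempty) (hd : DirectedOn (· ≤ ·) 𝒮)
    (hfd : ∀ S ∈ 𝒮, FiniteDimensional ℂ S) (hdense : Dense (⋃ S ∈ 𝒮, (S : Set A))) :
    ∃ ψ : A →⋆ₙₐ[ℂ] (H →L[ℂ] H), (∀ a : A, ψ a ∈ M) ∧
            ∀ x : A, ‖x‖ ≤ 1 → ‖φ x - ψ x‖ ≤ 1500000 * δ := by
  classical
  obtain ⟨π, hπ, hπc⟩ := stage2 hM h hδ0 hδ 𝒮 hne hd hfd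
  have hsm : 350000 * δ ≤ 1 / 100 := by norm_num at hδ ⊢; linarith
  have hlip := rep_lip h (hδ.trans (by norm_num)) hπ (fun u => (hπc u).trans (by linarith))
  let P : A → (H →L[ℂ] H) := fun a =>
    if ha : a ∈ WU (AU 𝒮 hne hd) then π ⟨⟨a, ha.1⟩, ha.2⟩ else 0
  have hPe : ∀ (a : A) (ha : a ∈ WU (AU 𝒮 hne hd)), P a = π ⟨⟨a, ha.1⟩, ha.2⟩ := fun a ha => dif_pos ha
  have hPR : PR M (AU 𝒮 hne hd) P := by
    constructor
    · intro a ha; rw [hPe a ha]; exact hπ.mem _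
    · intro a ha b hb; rw [hPe a ha, hPe b hb, hPe _ (WU_mul ha hb), ← hπ.mul]; rfl
    · rw [hPe 1 WU_one]; exact hπ.one
    · intro a ha; rw [hPe a ha, hPe _ (WU_star ha), hπ.star_eq]; rfl
    · intro a ha; rw [hPe a ha]; exact hπ.norm_le _
    · intro a ha b hb; rw [hPe a ha, hPe b hb]; exact hlip _ _
  have hc : ∀ a ∈ WU (AU 𝒮 hne hd), ‖P a - th φ a‖ ≤ 350000 * δ := by
    intro a ha; rw [hPe a ha]; exact hπc _
  obtain ⟨ψ, h1, h2⟩ := extend_main hPR h hδ0 (hδ.trans (by norm_num)) hc (by linarith)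
    (by
      rintro a ⟨S, hS, ha⟩
      exact ⟨S, fun x hx => ⟨S, hS, hx⟩, hfd S hS, ha⟩)
    (by
      refine hdense.mono fun x hx => ?_
      simp only [Set.mem_iUnion] at hx
      obtain ⟨S, hS, hx⟩ := hx
      exact ⟨S, hS, hx⟩)
  exact ⟨ψ, h1, fun x hx => (h2 x hx).trans (by linarith)⟩

end final
end UlamAF

/-- Ulam stability of the pair (unital AF algebras, von Neumann algebras): for every
`ε > 0` there is `δ > 0` such that any `δ`-*-homomorphism from a unital AF algebra into
a von Neumann algebra `M ⊆ B(H)` is within `ε` (on the closed unit ball) of an actual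
*-homomorphism into `M`. -/
theorem ulam_stability_AF_vonNeumann :
    ∀ ε : ℝ, 0 < ε → ∃ δ : ℝ, 0 < δ ∧
      ∀ (A : Type u) (H : Type v)
        [NormedRing A] [StarRing A] [CStarRing A] [NormedAlgebra ℂ A]
        [StarModule ℂ A] [CompleteSpace A]
        [NormedAddCommGroup H] [InnerProductSpace ℂ H] [CompleteSpace H]
        (M : VonNeumannAlgebra H) (φ : A → (H →L[ℂ] H)),
        IsAFAlgebra A → (∀ a : A, φ a ∈ M) → IsApproxStarHom δ φ →
          ∃ ψ : A →⋆ₙₐ[ℂ] (H →L[ℂ] H), (∀ a : A, ψ a ∈ M) ∧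
            ∀ x : A, ‖x‖ ≤ 1 → ‖φ x - ψ x‖ < ε := by
  intro ε hε
  have hδ0 : 0 < min (1 / 10 ^ 8 : ℝ) (ε / 10 ^ 7) := lt_min (by norm_num) (by positivity)
  refine ⟨min (1 / 10 ^ 8 : ℝ) (ε / 10 ^ 7), hδ0, ?_⟩
  intro A H _ _ _ _ _ _ _ _ _ M φ hAF hM h
  obtain ⟨𝒮, hne, hd, hfd, hdense⟩ := hAF
  let _ : CStarAlgebra A := {}
  obtain ⟨ψ, h1, h2⟩ := UlamAF.main_bound hM h hδ0 (min_le_left _ _) 𝒮 hne hd hfd hdense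
  refine ⟨ψ, h1, fun x hx => (h2 x hx).trans_lt ?_⟩
  have := min_le_right (1 / 10 ^ 8 : ℝ) (ε / 10 ^ 7)
  generalize min (1 / 10 ^ 8 : ℝ) (ε / 10 ^ 7) = d at *
  linarith
end

section
/- There exists ε₀ > 0 such that for every ε with 0 < ε < ε₀ the following holds: if F and G are finite-dimensional C*-algebras, π : U(F) → U(G) is a continuous group homomorphism between their unitary groups, and there exists an ε-*-homomorphism φ : F → G such that ‖φ(u) − π(u)‖ ≤ ε for every u ∈ U(F), then there is a *-homomorphism ψ : F → G with ψ(u) = π(u) for every u ∈ U(F). -/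
universe u v

namespace UExt

/-- `1 + (z-1) p`. -/
noncomputable def pu {A : Type*} [Ring A] [Algebra ℂ A] (p : A) (z : ℂ) : A := 1 + (z - 1) • p

lemma pu_mul {A : Type*} [Ring A] [Algebra ℂ A] {p : A} (hp : p * p = p) (a b : ℂ) :
    pu p a * pu p b = pu p (a * b) := by
  simp only [pu, mul_add, add_mul, one_mul, mul_one, smul_mul_assoc, mul_smul_comm, hp]
  module

lemma pu_one {A : Type*} [Ring A] [Algebra ℂ A] (p : A) : pu p 1 = 1 := by simp [pu]

lemma pu_pow {A : Type*} [Ring A] [Algebra ℂ A] {p : A} (hp : p * p = p) (a : ℂ) (n : ℕ) :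
    pu p a ^ n = pu p (a ^ n) := by
  induction n with
  | zero => simp [pu_one]
  | succ n ih => rw [pow_succ, ih, pu_mul hp, pow_succ]

lemma pu_star {A : Type*} [CStarAlgebra A] {p : A} (hp : IsStarProjection p) (a : ℂ) :
    star (pu p a) = pu p (star a) := by
  simp [pu, hp.isSelfAdjoint.star_eq]

lemma pu_mem {A : Type*} [CStarAlgebra A] {p : A} (hp : IsStarProjection p) {z : ℂ}
    (hz : ‖z‖ = 1) : pu p z ∈ unitary A := by
  have h1 : star z * z = 1 := by
    have := Complex.conj_mul' z
    simpa [hz] using this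
  rw [Unitary.mem_iff, pu_star hp, pu_mul hp.isIdempotentElem, pu_mul hp.isIdempotentElem,
    mul_comm z, h1, pu_one]
  exact ⟨rfl, rfl⟩

/-- No small subgroups. -/
lemma no_small {A : Type*} [NormedRing A] [NormedAlgebra ℂ A] (w : A) (h : ∀ n : ℕ, ‖w ^ n - 1‖ ≤ 1 / 2) :
    w = 1 := by
  have key : ∀ n : ℕ, (3 / 2 : ℝ) * ‖w ^ n - 1‖ ≤ ‖w ^ (2 * n) - 1‖ := by
    intro n
    have e : w ^ (2 * n) - 1 = ((w ^ n - 1) + (w ^ n - 1)) + (w ^ n - 1) * (w ^ n - 1) := by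
      rw [two_mul, pow_add]; noncomm_ring
    have e2 : (w ^ n - 1) + (w ^ n - 1)
        = (w ^ (2 * n) - 1) - (w ^ n - 1) * (w ^ n - 1) := by rw [e]; abel
    have h2 : ‖(w ^ n - 1) + (w ^ n - 1)‖ = ‖w ^ n - 1‖ + ‖w ^ n - 1‖ := by
      rw [← two_smul ℂ, norm_smul, Complex.norm_ofNat, two_mul]
    have h3 := norm_sub_le (w ^ (2 * n) - 1) ((w ^ n - 1) * (w ^ n - 1))
    rw [← e2, h2] at h3
    have h4 := norm_mul_le (w ^ n - 1) (w ^ n - 1)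
    nlinarith [h n, norm_nonneg (w ^ n - 1)]
  have key2 : ∀ m : ℕ, (3 / 2 : ℝ) ^ m * ‖w - 1‖ ≤ ‖w ^ (2 ^ m) - 1‖ := by
    intro m
    induction m with
    | zero => simp
    | succ m ih =>
      have := key (2 ^ m)
      rw [pow_succ' 2 m, pow_succ']
      nlinarith
  by_contra hne
  have hpos : 0 < ‖w - 1‖ := norm_pos_iff.2 (sub_ne_zero.2 hne)
  obtain ⟨m, hm⟩ := pow_unbounded_of_one_lt (1 / ‖w - 1‖) (by norm_num : (1 : ℝ) < 3 / 2)
  rw [div_lt_iff₀ hpos] at hm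
  linarith [key2 m, h (2 ^ m)]

/-- Average-type estimate. -/
lemma pow_sub_one_lower {A : Type*} [NormedRing A] [NormedAlgebra ℂ A] (v : A) (n : ℕ)
    (h : ∀ k < n, ‖v ^ k - 1‖ ≤ 1 / 2) : n * ‖v - 1‖ ≤ 2 * ‖v ^ n - 1‖ := by
  have e : (n : ℂ) • (v - 1) = (v ^ n - 1) - (v - 1) * ∑ k ∈ Finset.range n, (v ^ k - 1) := by
    rw [Finset.sum_sub_distrib, mul_sub, mul_geom_sum]
    simp [Nat.cast_smul_eq_nsmul, nsmul_eq_mul, (Nat.cast_commute n (v - 1)).eq]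
  have h1 : ‖∑ k ∈ Finset.range n, (v ^ k - 1)‖ ≤ n * (1 / 2) := by
    refine (norm_sum_le_of_le _ (fun k hk => h k (Finset.mem_range.1 hk))).trans ?_
    simp
  have h2 : ‖(n : ℂ) • (v - 1)‖ = n * ‖v - 1‖ := by simp [norm_smul]
  have h3 := norm_sub_le (v ^ n - 1) ((v - 1) * ∑ k ∈ Finset.range n, (v ^ k - 1))
  rw [← e, h2] at h3
  have h4 := norm_mul_le (v - 1) (∑ k ∈ Finset.range n, (v ^ k - 1))
  have h5 := mul_le_mul_of_nonneg_left h1 (norm_nonneg (v - 1))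
  linarith

lemma pow_sub_one_upper {A : Type*} [CStarAlgebra A] (v : unitary A) (n : ℕ) :
    ‖((v ^ n : unitary A) : A) - 1‖ ≤ n * ‖(v : A) - 1‖ := by
  induction n with
  | zero => simp
  | succ n ih =>
    have : ((v ^ (n + 1) : unitary A) : A) - 1
        = (((v ^ n : unitary A) : A) - 1) * v + ((v : A) - 1) := by
      rw [pow_succ]; push_cast; noncomm_ring
    rw [this]
    refine (norm_add_le _ _).trans ?_
    rw [CStarRing.norm_mul_coe_unitary, Nat.cast_succ]
    linarith

/-- Finite spectral decomposition of unitaries. -/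
lemma spectral {A : Type*} [CStarAlgebra A] [FiniteDimensional ℂ A] (u : unitary A) :
    ∃ (S : Finset ℂ) (e : ℂ → A), (∀ z, IsStarProjection (e z)) ∧
      (∀ z w, z ≠ w → e z * e w = 0) ∧ (∑ z ∈ S, e z = 1) ∧ (∑ z ∈ S, z • e z = (u : A)) ∧
      ∀ z ∈ S, ‖z‖ = 1 := by
  have hfin : (spectrum ℂ (u : A)).Finite := by
    have hint : IsIntegral ℂ (u : A) := Algebra.IsIntegral.isIntegral _
    refine ((minpoly ℂ (u : A)).roots.toFinset.finite_toSet).subset fun m hm => ?_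
    have h := spectrum.subset_polynomial_aeval (u : A) (minpoly ℂ (u : A)) ⟨m, hm, rfl⟩
    rw [minpoly.aeval, spectrum.mem_iff, sub_zero] at h
    simp only [Finset.mem_coe, Multiset.mem_toFinset]
    rw [Polynomial.mem_roots (minpoly.ne_zero hint)]
    by_contra h0
    exact h ((IsUnit.mk0 _ h0).map (algebraMap ℂ A))
  have hc : ∀ f : ℂ → ℂ, ContinuousOn f (spectrum ℂ (u : A)) := fun f => hfin.continuousOn f
  have hn : IsStarNormal (u : A) := inferInstance
  refine ⟨hfin.toFinset, fun z => cfc (fun w : ℂ => if w = z then (1 : ℂ) else 0) (u : A),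
    fun z => ⟨?_, ?_⟩, fun z w hzw => ?_, ?_, ?_, ?_⟩
  · rw [IsIdempotentElem, ← cfc_mul _ _ _ (hc _) (hc _)]
    congr 1; ext w; split_ifs <;> simp
  · rw [IsSelfAdjoint, ← cfc_star]
    congr 1; ext w; split_ifs <;> simp
  · rw [← cfc_mul _ _ _ (hc _) (hc _)]
    rw [← cfc_zero (R := ℂ) (a := (u : A))]
    congr 1; ext x; simp only [Pi.zero_apply]
    by_cases h : x = z
    · simp [h, hzw]
    · simp [h]
  · rw [← cfc_sum _ _ _ (fun _ _ => hc _), ← cfc_const_one ℂ (u : A)]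
    refine cfc_congr fun x hx => ?_
    simp [hx]
  · simp_rw [← cfc_const_mul _ _ _ (hc _)]
    rw [← cfc_sum _ _ _ (fun _ _ => hc _)]
    conv_rhs => rw [← cfc_id' ℂ (u : A)]
    refine cfc_congr fun x hx => ?_
    simp
    intro h; exact absurd hx h
  · intro z hz
    exact spectrum.norm_eq_one_of_unitary u.2 (hfin.mem_toFinset.1 hz)


lemma exists_proj {F G : Type*} [CStarAlgebra F] [CStarAlgebra G] (π : unitary F →* unitary G)
    {ε : ℝ} (he : ε < 1 / 20) {φ : F → G}
    (hadd : ∀ x y : F, ‖x‖ ≤ 1 → ‖y‖ ≤ 1 → ‖φ (x + y) - φ x - φ y‖ ≤ ε)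
    (hsm : ∀ (x : F) (l : ℂ), ‖x‖ ≤ 1 → ‖l‖ ≤ 1 → ‖φ (l • x) - l • φ x‖ ≤ ε)
    (hφ : ∀ u : unitary F, ‖φ (u : F) - (π u : G)‖ ≤ ε) {p : F} (hp : IsStarProjection p) :
    ∃ q : G, IsStarProjection q ∧
      ∀ u : unitary F, ∀ z : ℂ, ‖z‖ = 1 → (u : F) = pu p z → (π u : G) = pu q z := by
  have hpn : ‖p‖ ≤ 1 := hp.norm_le
  have hpn' : ‖1 - p‖ ≤ 1 := hp.one_sub.norm_le
  have happ : ∀ u : unitary F, ∀ z : ℂ, ‖z‖ = 1 → (u : F) = pu p z →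
      ‖(π u : G) - (φ (1 - p) + z • φ p)‖ ≤ 3 * ε := by
    intro u z hz hu
    have h1 := hφ u
    have h2 := hadd (1 - p) (z • p) hpn' (by simpa [norm_smul, hz] using hpn)
    have h3 := hsm p z hpn hz.le
    have e1 : (1 - p) + z • p = u := by rw [hu, pu]; module
    rw [e1] at h2
    have e2 : (π u : G) - (φ (1 - p) + z • φ p) = -(φ (u : F) - (π u : G)) +
      (φ (u : F) - φ (1 - p) - φ (z • p)) + (φ (z • p) - z • φ p) := by abel
    rw [e2]
    refine (norm_add₃_le).trans ?_
    rw [norm_neg]; linarith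
  let s : unitary F := ⟨pu p (-1), pu_mem hp (by simp)⟩
  have hss : π s * π s = 1 := by
    rw [← map_mul]
    have : s * s = 1 := by
      ext; simp [s, pu_mul hp.isIdempotentElem, pu_one]
    rw [this, map_one]
  have hss' : (π s : G) * (π s : G) = 1 := by
    simpa using congrArg (Subtype.val) hss
  have hstar : star (π s : G) = π s := by
    have h1 : star (π s) = π s := by
      rw [Unitary.star_eq_inv] ; exact inv_eq_of_mul_eq_one_left hss
    simpa using congrArg (Subtype.val) h1
  set q : G := (1 / 2 : ℂ) • (1 - (π s : G)) with hq
  have hqp : IsStarProjection q := by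
    refine ⟨?_, ?_⟩
    · rw [IsIdempotentElem, hq]
      simp only [smul_mul_assoc, mul_smul_comm, mul_sub, sub_mul, one_mul, mul_one, hss']
      module
    · rw [IsSelfAdjoint, hq]
      simp [hstar]
  refine ⟨q, hqp, ?_⟩
  have hs := happ s (-1) (by simp) rfl
  have h1 := happ 1 1 (by simp) (by simp [pu_one])
  have hclose : ∀ u : unitary F, ∀ z : ℂ, ‖z‖ = 1 → (u : F) = pu p z →
      ‖(π u : G) - pu q z‖ ≤ 9 * ε := by
    intro u z hz hu
    have h2 := happ u z hz hu
    rw [map_one] at h1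
    set X := (((1 : unitary G) : G) - (φ (1 - p) + (1 : ℂ) • φ p)) with hX
    set Y := ((π s : G) - (φ (1 - p) + (-1 : ℂ) • φ p)) with hY
    have e : (π u : G) - pu q z = ((π u : G) - (φ (1 - p) + z • φ p)) +
        ((-(1 + z) / 2) • X + (-(1 - z) / 2) • Y) := by
      rw [hX, hY, hq, pu]
      simp only [OneMemClass.coe_one]
      module
    have ha : ‖-(1 + z) / 2‖ ≤ 1 := by
      have := norm_add_le 1 z
      rw [hz] at this
      rw [norm_div, norm_neg]; simp at this ⊢; linarith
    have hb : ‖-(1 - z) / 2‖ ≤ 1 := by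
      have := norm_sub_le 1 z
      rw [hz] at this
      rw [norm_div, norm_neg]; simp at this ⊢; linarith
    have h3 : ‖(-(1 + z) / 2) • X‖ ≤ 3 * ε := by
      rw [norm_smul]; nlinarith [norm_nonneg X]
    have h4 : ‖(-(1 - z) / 2) • Y‖ ≤ 3 * ε := by
      rw [norm_smul]; nlinarith [norm_nonneg Y]
    rw [e]
    have h5 := norm_add_le ((π u : G) - (φ (1 - p) + z • φ p))
        ((-(1 + z) / 2) • X + (-(1 - z) / 2) • Y)
    have h6 := norm_add_le ((-(1 + z) / 2) • X) ((-(1 - z) / 2) • Y)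
    linarith
  intro u z hz hu
  let w : unitary G := ⟨pu q z, pu_mem hqp hz⟩
  have hcom0 : u * s = s * u := by
    ext; simp [s, hu, pu_mul hp.isIdempotentElem]
  have hcom1 : (π u : G) * π s = π s * π u := by
    have := congrArg (fun t => ((π t : unitary G) : G)) hcom0
    simpa using this
  have hcom : Commute (π u) w := by
    ext
    simp only [w, Submonoid.coe_mul, pu, hq, mul_add, add_mul, mul_smul_comm, smul_mul_assoc,
      mul_sub, sub_mul, hcom1, one_mul, mul_one]
  have hone : ((π u * star w : unitary G) : G) = 1 := by
    apply no_small
    intro n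
    have e0 : ((u ^ n : unitary F) : F) = pu p (z ^ n) := by
      simp [hu, pu_pow hp.isIdempotentElem]
    have h := hclose (u ^ n) (z ^ n) (by simp [hz]) e0
    have e1 : pu q (z ^ n) = ((w ^ n : unitary G) : G) := by
      simp [w, pu_pow hqp.isIdempotentElem]
    have e2 : ((π u * star w : unitary G) : G) ^ n - 1
        = ((π (u ^ n) : G) - pu q (z ^ n)) * ((star (w ^ n) : unitary G) : G) := by
      have hc : Commute (π u) (star w) := by
        rw [Unitary.star_eq_inv]; exact hcom.inv_right
      have : (π u * star w) ^ n = π (u ^ n) * star (w ^ n) := by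
        rw [hc.mul_pow, map_pow, star_pow]
      rw [e1, sub_mul, ← Submonoid.coe_mul, ← Submonoid.coe_mul, ← SubmonoidClass.coe_pow, this,
        Unitary.mul_star_self, OneMemClass.coe_one]
    rw [e2, CStarRing.norm_mul_coe_unitary]
    linarith
  have h2 : π u * star w = 1 := Subtype.ext hone
  have h3 : π u = w := by
    rw [Unitary.star_eq_inv] at h2; exact mul_inv_eq_one.1 h2
  rw [h3]

lemma deriv_zero {F G : Type*} [CStarAlgebra F] [CStarAlgebra G] (π : unitary F →* unitary G)
    (hπ : Continuous π) (f : ℝ → unitary F) (h0 : f 0 = 1)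
    (hf : HasDerivAt (fun t => (f t : F)) 0 0) {Y : G}
    (hg : HasDerivAt (fun t => (π (f t) : G)) Y 0) : Y = 0 := by
  have hinv : Filter.Tendsto (fun n : ℕ => (1 / ((n : ℝ) + 1) : ℝ)) Filter.atTop
      (nhdsWithin 0 {0}ᶜ) := by
    refine tendsto_nhdsWithin_iff.2 ⟨tendsto_one_div_add_atTop_nhds_zero_nat, ?_⟩
    refine Filter.Eventually.of_forall fun n => ?_
    simp only [Set.mem_compl_iff, Set.mem_singleton_iff]
    positivity
  have hF := ((hasDerivAt_iff_tendsto_slope_zero.1 hf).comp hinv).norm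
  have hG := ((hasDerivAt_iff_tendsto_slope_zero.1 hg).comp hinv).norm
  simp only [Function.comp_def, zero_add, h0, map_one, OneMemClass.coe_one, norm_smul,
    norm_zero] at hF hG
  have hnorm : ∀ n : ℕ, ‖(1 / ((n : ℝ) + 1))⁻¹‖ = ((n + 1 : ℕ) : ℝ) := by
    intro n
    rw [one_div, inv_inv, Real.norm_of_nonneg (by positivity)]
    push_cast; rfl
  simp only [hnorm] at hF hG
  -- continuity of π at 1
  have hcont : ∀ δ : ℝ, 0 < δ → ∃ η : ℝ, 0 < η ∧ ∀ u : unitary F, ‖(u : F) - 1‖ < η →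
      ‖(π u : G) - 1‖ < δ := by
    intro δ hδ
    obtain ⟨η, hη, h⟩ := Metric.continuous_iff.1 hπ 1 δ hδ
    refine ⟨η, hη, fun u hu => ?_⟩
    have := h u (by rw [Subtype.dist_eq, dist_eq_norm]; simpa using hu)
    rw [Subtype.dist_eq, dist_eq_norm] at this
    simpa using this
  have hle : ∀ δ : ℝ, 0 < δ → ‖Y‖ ≤ δ := by
    intro δ hδ
    obtain ⟨η, hη, h⟩ := hcont (min (1 / 2) (δ / 2)) (by positivity)
    refine le_of_tendsto hG ?_
    filter_upwards [hF.eventually (gt_mem_nhds hη)] with n hn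
    set w := f (1 / ((n : ℝ) + 1))
    have hk : ∀ k ≤ n + 1, ‖(π w : G) ^ k - 1‖ < min (1 / 2) (δ / 2) := by
      intro k hk
      have h1 := h (w ^ k) (by
        refine (pow_sub_one_upper w k).trans_lt (lt_of_le_of_lt ?_ hn)
        gcongr)
      simpa using h1
    have h2 := pow_sub_one_lower (π w : G) (n + 1)
      (fun k hk' => ((hk k hk'.le).trans_le (min_le_left _ _)).le)
    have h3 := (hk (n + 1) le_rfl).trans_le (min_le_right _ _)
    linarith
  have : ‖Y‖ ≤ 0 := le_of_forall_pos_le_add (by simpa using hle)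
  simpa using this

lemma pu_hasDerivAt {A : Type*} [CStarAlgebra A] (p : A) (r : ℝ) :
    HasDerivAt (fun t : ℝ => pu p (Complex.exp ((r * t : ℝ) * Complex.I)))
      (Complex.I • ((r : ℂ) • p)) 0 := by
  have h1 : HasDerivAt (fun t : ℝ => Complex.exp ((r * t : ℝ) * Complex.I))
      (r * Complex.I) 0 := by
    have h2 : HasDerivAt (fun t : ℝ => ((r * t : ℝ) : ℂ) * Complex.I) (r * Complex.I) 0 := by
      have h3 : HasDerivAt (fun t : ℝ => r * t) r 0 := by
        simpa using (hasDerivAt_id (0 : ℝ)).const_mul r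
      exact h3.ofReal_comp.mul_const _
    simpa using h2.cexp
  have h4 := ((h1.sub_const 1).smul_const p).const_add (1 : A)
  rw [smul_smul, mul_comm Complex.I]
  exact h4

lemma exists_path {F G : Type*} [CStarAlgebra F] [CStarAlgebra G] (π : unitary F →* unitary G)
    {ι : Type*} (P : ι → F) (Q : ι → G) (hP : ∀ i, IsStarProjection (P i))
    (hQ : ∀ i, ∀ u : unitary F, ∀ z : ℂ, ‖z‖ = 1 → (u : F) = pu (P i) z → (π u : G) = pu (Q i) z)
    (r : ι → ℝ) (s : Finset ι) :
    ∃ f : ℝ → unitary F, f 0 = 1 ∧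
      HasDerivAt (fun t => (f t : F)) (∑ i ∈ s, Complex.I • ((r i : ℂ) • P i)) 0 ∧
      HasDerivAt (fun t => (π (f t) : G)) (∑ i ∈ s, Complex.I • ((r i : ℂ) • Q i)) 0 := by
  classical
  induction s using Finset.induction_on with
  | empty => exact ⟨fun _ => 1, rfl, by simpa using hasDerivAt_const _ _,
      by simpa using hasDerivAt_const _ _⟩
  | insert a s ha ih =>
    obtain ⟨f, f0, f1, f2⟩ := ih
    have hz : ∀ t : ℝ, ‖Complex.exp ((r a * t : ℝ) * Complex.I)‖ = 1 :=
      fun t => Complex.norm_exp_ofReal_mul_I _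
    let g : ℝ → unitary F := fun t => ⟨pu (P a) (Complex.exp ((r a * t : ℝ) * Complex.I)),
      pu_mem (hP a) (hz t)⟩
    have g0 : g 0 = 1 := by ext; simp [g, pu_one]
    have g1 : HasDerivAt (fun t => (g t : F)) (Complex.I • ((r a : ℂ) • P a)) 0 :=
      pu_hasDerivAt (P a) (r a)
    have g2 : HasDerivAt (fun t => (π (g t) : G)) (Complex.I • ((r a : ℂ) • Q a)) 0 := by
      have : (fun t => (π (g t) : G)) =
          fun t => pu (Q a) (Complex.exp ((r a * t : ℝ) * Complex.I)) := by
        ext t; exact hQ a (g t) _ (hz t) rfl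
      rw [this]; exact pu_hasDerivAt (Q a) (r a)
    refine ⟨fun t => g t * f t, by simp [g0, f0], ?_, ?_⟩
    · have := g1.mul f1
      simpa [g0, f0, Finset.sum_insert ha, Pi.mul_def] using this
    · have := g2.mul f2
      simpa [g0, f0, Finset.sum_insert ha, Pi.mul_def] using this

lemma rel_real {F G : Type*} [CStarAlgebra F] [CStarAlgebra G] (π : unitary F →* unitary G)
    (hπ : Continuous π)
    {ι : Type*} (P : ι → F) (Q : ι → G) (hP : ∀ i, IsStarProjection (P i))
    (hQ : ∀ i, ∀ u : unitary F, ∀ z : ℂ, ‖z‖ = 1 → (u : F) = pu (P i) z → (π u : G) = pu (Q i) z)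
    (r : ι → ℝ) (s : Finset ι) (h : ∑ i ∈ s, (r i : ℂ) • P i = 0) :
    ∑ i ∈ s, (r i : ℂ) • Q i = 0 := by
  obtain ⟨f, f0, f1, f2⟩ := exists_path π P Q hP hQ r s
  rw [← Finset.smul_sum, h, smul_zero] at f1
  have := deriv_zero π hπ f f0 f1 f2
  rw [← Finset.smul_sum] at this
  exact (smul_eq_zero.1 this).resolve_left Complex.I_ne_zero

lemma rel_complex {F G : Type*} [CStarAlgebra F] [CStarAlgebra G] (π : unitary F →* unitary G)
    (hπ : Continuous π)
    {ι : Type*} (P : ι → F) (Q : ι → G) (hP : ∀ i, IsStarProjection (P i))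
    (hQ : ∀ i, ∀ u : unitary F, ∀ z : ℂ, ‖z‖ = 1 → (u : F) = pu (P i) z → (π u : G) = pu (Q i) z)
    (c : ι → ℂ) (s : Finset ι) (h : ∑ i ∈ s, c i • P i = 0) :
    ∑ i ∈ s, c i • Q i = 0 := by
  have hs : ∑ i ∈ s, star (c i) • P i = 0 := by
    have := congrArg star h
    simpa [star_sum, (hP _).isSelfAdjoint.star_eq] using this
  have hre : ∑ i ∈ s, (((c i).re : ℝ) : ℂ) • P i = 0 := by
    have e : ∀ i, (((c i).re : ℝ) : ℂ) • P i = (1 / 2 : ℂ) • (c i • P i + star (c i) • P i) := by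
      intro i
      rw [← add_smul, smul_smul, Complex.re_eq_add_conj, starRingEnd_apply]; ring_nf
    simp_rw [e]
    rw [← Finset.smul_sum, Finset.sum_add_distrib, h, hs]; simp
  have him : ∑ i ∈ s, (((c i).im : ℝ) : ℂ) • P i = 0 := by
    have e : ∀ i, (((c i).im : ℝ) : ℂ) • P i
        = (1 / (2 * Complex.I) : ℂ) • (c i • P i - star (c i) • P i) := by
      intro i
      rw [← sub_smul, smul_smul, Complex.im_eq_sub_conj, starRingEnd_apply]; ring_nf
    simp_rw [e]
    rw [← Finset.smul_sum, Finset.sum_sub_distrib, h, hs]; simp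
  have h1 := rel_real π hπ P Q hP hQ _ s hre
  have h2 := rel_real π hπ P Q hP hQ _ s him
  have e : ∀ i, c i • Q i = (((c i).re : ℝ) : ℂ) • Q i + Complex.I • (((c i).im : ℝ) : ℂ) • Q i := by
    intro i
    rw [smul_smul, ← add_smul, mul_comm Complex.I, Complex.re_add_im]
  simp_rw [e]
  rw [Finset.sum_add_distrib, ← Finset.smul_sum, h1, h2]; simp

theorem main {F G : Type*} [CStarAlgebra F] [CStarAlgebra G] [FiniteDimensional ℂ F]
    (π : unitary F →* unitary G) (hπ : Continuous π)
    {ε : ℝ} (he : ε < 1 / 20) {φ : F → G}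
    (hadd : ∀ x y : F, ‖x‖ ≤ 1 → ‖y‖ ≤ 1 → ‖φ (x + y) - φ x - φ y‖ ≤ ε)
    (hsm : ∀ (x : F) (l : ℂ), ‖x‖ ≤ 1 → ‖l‖ ≤ 1 → ‖φ (l • x) - l • φ x‖ ≤ ε)
    (hφ : ∀ u : unitary F, ‖φ (u : F) - (π u : G)‖ ≤ ε) :
    ∃ ψ : F →⋆ₙₐ[ℂ] G, ∀ u : unitary F, ψ (u : F) = (π u : G) := by
  classical
  let ι := {p : F // IsStarProjection p}
  have hex := fun i : ι => exists_proj π he hadd hsm hφ i.2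
  choose Q hQp hQ using hex
  let P : ι → F := Subtype.val
  have hP : ∀ i, IsStarProjection (P i) := fun i => i.2
  let L1 := Finsupp.linearCombination ℂ P
  let L2 := Finsupp.linearCombination ℂ Q
  have hker : ∀ c, L1 c = 0 → L2 c = 0 := by
    intro c hc
    simp only [L1, L2, Finsupp.linearCombination_apply, Finsupp.sum] at hc ⊢
    exact rel_complex π hπ P Q hP hQ c c.support hc
  have hsurj : LinearMap.range L1 = ⊤ := by
    rw [Finsupp.range_linearCombination, eq_top_iff, ← CStarAlgebra.span_unitary F,
      Submodule.span_le]
    intro u hu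
    obtain ⟨S, e, he1, -, -, he2, -⟩ := spectral ⟨u, hu⟩
    rw [← show _ = u from he2]
    exact sum_mem fun z _ => Submodule.smul_mem _ _ (Submodule.subset_span ⟨⟨e z, he1 z⟩, rfl⟩)
  obtain ⟨R, hR⟩ := LinearMap.exists_rightInverse_of_surjective L1 hsurj
  let ψ : F →ₗ[ℂ] G := L2 ∘ₗ R
  have hψP : ∀ i, ψ (P i) = Q i := by
    intro i
    have h1 : L1 (R (P i) - Finsupp.single i 1) = 0 := by
      have : L1 (R (P i)) = P i := LinearMap.congr_fun hR (P i)
      rw [map_sub, this]; simp [L1]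
    have h2 := hker _ h1
    rw [map_sub, sub_eq_zero] at h2
    simpa [ψ, L2] using h2
  have hproj : ∀ p : F, IsStarProjection p → IsStarProjection (ψ p) := by
    intro p hp
    have := hψP ⟨p, hp⟩
    rw [show P ⟨p, hp⟩ = p from rfl] at this
    rw [this]; exact hQp _
  have hpu : ∀ p : F, IsStarProjection p → ∀ u : unitary F, ∀ z : ℂ, ‖z‖ = 1 →
      (u : F) = pu p z → (π u : G) = pu (ψ p) z := by
    intro p hp u z hz hu
    have := hψP ⟨p, hp⟩
    rw [show P ⟨p, hp⟩ = p from rfl] at this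
    rw [this]; exact hQ ⟨p, hp⟩ u z hz hu
  -- unit
  have hone : ψ 1 = 1 := by
    have hq := (hproj 1 (IsStarProjection.one F)).one_sub
    have hs : ((-1 : unitary F) : F) = pu 1 (-1) := by
      simp only [pu, Unitary.coe_neg, OneMemClass.coe_one]; module
    have h1 := hpu 1 (IsStarProjection.one F) (-1) (-1) (by simp) hs
    have h2 := hφ (-1)
    have h3 := hφ 1
    have hn1 : ‖(1 : F)‖ ≤ 1 := (IsStarProjection.one F).norm_le
    have h4 := hsm 1 (-1) hn1 (by simp)
    rw [h1] at h2
    simp only [map_one, OneMemClass.coe_one, Unitary.coe_neg] at h2 h3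
    rw [neg_one_smul, neg_one_smul] at h4
    have e : (2 : ℂ) • (1 - ψ 1) = (φ (-1) - - φ 1) - (φ (-1) - pu (ψ 1) (-1)) - (φ 1 - 1) := by
      simp only [pu]; module
    have h5 : ‖(2 : ℂ) • (1 - ψ 1)‖ ≤ 3 * ε := by
      rw [e]
      have a1 := norm_sub_le ((φ (-1) - - φ 1) - (φ (-1) - pu (ψ 1) (-1))) (φ 1 - 1)
      have a2 := norm_sub_le (φ (-1) - - φ 1) (φ (-1) - pu (ψ 1) (-1))
      linarith
    rw [norm_smul, Complex.norm_ofNat] at h5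
    have h6 : ‖1 - ψ 1‖ ≤ ‖1 - ψ 1‖ * ‖1 - ψ 1‖ := by
      conv_lhs => rw [← hq.isIdempotentElem.eq]
      exact norm_mul_le _ _
    have h7 : ‖1 - ψ 1‖ = 0 := by
      nlinarith [norm_nonneg (1 - ψ 1)]
    exact (sub_eq_zero.1 (norm_eq_zero.1 h7)).symm
  have horth : ∀ p q : F, IsStarProjection p → IsStarProjection q → p * q = 0 →
      ψ p * ψ q = 0 := by
    intro p q hp hq hpq
    have hqp : q * p = 0 := by
      simpa [hp.isSelfAdjoint.star_eq, hq.isSelfAdjoint.star_eq] using congrArg star hpq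
    have h1 := (hproj _ (hp.add hq hpq)).isIdempotentElem.eq
    have hp' := (hproj _ hp).isIdempotentElem.eq
    have hq' := (hproj _ hq).isIdempotentElem.eq
    rw [map_add, mul_add, add_mul, add_mul, hp', hq'] at h1
    have hA : ψ p * ψ q = - (ψ q * ψ p) := by
      rw [← sub_eq_zero] at h1
      rw [eq_neg_iff_add_eq_zero, ← h1]; abel
    have h2 : ψ p * ψ q = - (ψ p * ψ q * ψ p) := by
      calc ψ p * ψ q = ψ p * (ψ p * ψ q) := by rw [← mul_assoc, hp']
        _ = _ := by rw [hA, mul_neg, ← mul_assoc, hA]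
    have h3 : ψ p * ψ q * ψ p = 0 := by
      have h4 := congrArg (· * ψ p) h2
      simp only [neg_mul, mul_assoc, hp'] at h4
      rw [← mul_assoc] at h4
      have h5 : (2 : ℂ) • (ψ p * ψ q * ψ p) = 0 := by
        rw [two_smul]
        nth_rewrite 1 [h4]
        exact neg_add_cancel _
      exact (smul_eq_zero.1 h5).resolve_left two_ne_zero
    rw [h2, h3, neg_zero]
  have hψu : ∀ u : unitary F, ψ (u : F) = (π u : G) := by
    intro u
    obtain ⟨S, e, he1, heo, hes, he2, hn⟩ := spectral u
    have key : ∀ T : Finset ℂ, T ⊆ S → ∃ w : unitary F,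
        (w : F) = 1 + ∑ z ∈ T, (z - 1) • e z ∧ (π w : G) = ψ w := by
      intro T
      induction T using Finset.induction_on with
      | empty => exact fun _ => ⟨1, by simp, by simp [hone]⟩
      | insert a T ha ih =>
        intro hT
        obtain ⟨w, hw1, hw2⟩ := ih ((Finset.subset_insert _ _).trans hT)
        have han := hn a (hT (Finset.mem_insert_self _ _))
        let v : unitary F := ⟨pu (e a) a, pu_mem (he1 a) han⟩
        have hv := hpu (e a) (he1 a) v a han rfl
        refine ⟨v * w, ?_, ?_⟩
        · rw [Submonoid.coe_mul, hw1, Finset.sum_insert ha]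
          have hz : e a * ∑ z ∈ T, (z - 1) • e z = 0 := by
            rw [Finset.mul_sum]
            refine Finset.sum_eq_zero fun z hz => ?_
            rw [mul_smul_comm, heo a z (by rintro rfl; exact ha hz), smul_zero]
          simp only [v, pu, add_mul, mul_add, one_mul, mul_one, smul_mul_assoc, hz, smul_zero]
          abel
        · have hz : e a * ∑ z ∈ T, (z - 1) • e z = 0 := by
            rw [Finset.mul_sum]
            refine Finset.sum_eq_zero fun z hz => ?_
            rw [mul_smul_comm, heo a z (by rintro rfl; exact ha hz), smul_zero]
          have hz' : ψ (e a) * ∑ z ∈ T, (z - 1) • ψ (e z) = 0 := by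
            rw [Finset.mul_sum]
            refine Finset.sum_eq_zero fun z hz => ?_
            rw [mul_smul_comm, horth _ _ (he1 a) (he1 z) (heo a z (by rintro rfl; exact ha hz)),
              smul_zero]
          rw [map_mul, Submonoid.coe_mul, hv, hw2, Submonoid.coe_mul, hw1]
          simp only [v, pu, add_mul, mul_add, one_mul, mul_one, smul_mul_assoc, hz, smul_zero,
            map_add, map_sum, map_smul, hone, hz', map_zero]
    obtain ⟨w, hw1, hw2⟩ := key S subset_rfl
    have : w = u := by
      ext
      rw [hw1, ← he2]
      simp_rw [sub_smul, one_smul]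
      rw [Finset.sum_sub_distrib, hes]; abel
    rw [← this, hw2]
  have hind : ∀ x : F, x ∈ Submodule.span ℂ (unitary F : Set F) := by
    intro x; rw [CStarAlgebra.span_unitary]; trivial
  have hmul : ∀ x y, ψ (x * y) = ψ x * ψ y := by
    intro x y
    induction hind x using Submodule.span_induction with
    | zero => simp
    | add a b _ _ ha hb => simp [add_mul, ha, hb]
    | smul c a _ ha => simp [ha]
    | mem u hu =>
      induction hind y using Submodule.span_induction with
      | zero => simp
      | add a b _ _ ha hb => simp [mul_add, ha, hb]
      | smul c a _ ha => simp [ha]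
      | mem v hv =>
        have h1 := hψu ⟨u, hu⟩
        have h2 := hψu ⟨v, hv⟩
        have h3 := hψu (⟨u, hu⟩ * ⟨v, hv⟩)
        rw [map_mul, Submonoid.coe_mul, Submonoid.coe_mul, ← h1, ← h2] at h3
        exact h3
  have hstar : ∀ x, ψ (star x) = star (ψ x) := by
    intro x
    induction hind x using Submodule.span_induction with
    | zero => simp
    | add a b _ _ ha hb => simp [ha, hb]
    | smul c a _ ha => simp [ha]
    | mem u hu =>
      have h1 := hψu ⟨u, hu⟩
      have h2 := hψu (star ⟨u, hu⟩)
      rw [Unitary.star_eq_inv, map_inv, ← Unitary.star_eq_inv, ← Unitary.star_eq_inv,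
        Unitary.coe_star, Unitary.coe_star, ← h1] at h2
      exact h2
  exact ⟨{ toFun := ψ, map_smul' := fun c x => by simp, map_zero' := map_zero ψ,
           map_add' := map_add ψ, map_mul' := hmul, map_star' := hstar }, hψu⟩

end UExt

/-- Farah's lemma: for sufficiently small `ε`, a continuous group homomorphism between
the unitary groups of two finite-dimensional C*-algebras which is `ε`-close to an
`ε`-*-homomorphism extends to a genuine *-homomorphism. -/
theorem unitary_rep_extends_to_starHom :
    ∃ ε₀ : ℝ, 0 < ε₀ ∧
      ∀ ε : ℝ, 0 < ε → ε < ε₀ →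
      ∀ (F : Type u) (G : Type v)
        [NormedRing F] [StarRing F] [CStarRing F] [NormedAlgebra ℂ F]
        [StarModule ℂ F] [CompleteSpace F] [FiniteDimensional ℂ F]
        [NormedRing G] [StarRing G] [CStarRing G] [NormedAlgebra ℂ G]
        [StarModule ℂ G] [CompleteSpace G] [FiniteDimensional ℂ G]
        (π : unitary F →* unitary G), Continuous π →
        (∃ φ : F → G, IsApproxStarHom ε φ ∧
          ∀ u : unitary F, ‖φ (u : F) - (π u : G)‖ ≤ ε) →
        ∃ ψ : F →⋆ₙₐ[ℂ] G, ∀ u : unitary F, ψ (u : F) = (π u : G) := by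
  refine ⟨1 / 20, by norm_num, ?_⟩
  intro ε _ he F G _ _ _ _ _ _ _ _ _ _ _ _ _ _ π hπ
  rintro ⟨φ, ⟨hadd, hsm, -, -, -⟩, hφ⟩
  letI : CStarAlgebra F := { }
  letI : CStarAlgebra G := { }
  exact UExt.main π hπ he hadd hsm hφ
end
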